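/- If G is a minimal counterexample, then G contains no cycle of length 5. -/

import Mathlib

open SimpleGraph

/-- A `(1,2^k)`-packing edge-coloring encoded as a function assigning a color in
`Fin (k+1)` to each unordered pair. Color `0` is the 1-color (its class must be a
matching) and each color `i ≠ 0` is a 2-color (its class must be an induced matching). -/
def IsPackingEC {V : Type} (G : SimpleGraph V) (k : ℕ)
    (c : Sym2 V → Fin (k + 1)) : Prop :=
  (∀ a b x y : V, G.Adj a b → G.Adj x y → s(a, b) ≠ s(x, y) →
      c s(a, b) = 0 → c s(x, y) = 0 →
      a ≠ x ∧ a ≠ y ∧ b ≠ x ∧ b ≠ y) ∧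
  ∀ a b x y : V, G.Adj a b → G.Adj x y → s(a, b) ≠ s(x, y) →
      c s(a, b) = c s(x, y) → c s(a, b) ≠ 0 →
      (a ≠ x ∧ a ≠ y ∧ b ≠ x ∧ b ≠ y) ∧
      ¬G.Adj a x ∧ ¬G.Adj a y ∧ ¬G.Adj b x ∧ ¬G.Adj b y

/-- A good coloring: a `(1,2^7)`-packing edge-coloring in which every edge of the
1-color class (color `0`) has both endpoints of degree 3. -/
def GoodColoring {V : Type} (G : SimpleGraph V) (c : Sym2 V → Fin 8) : Prop :=
  IsPackingEC G 7 c ∧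
  ∀ a b : V, G.Adj a b → c s(a, b) = 0 →
    (G.neighborSet a).ncard = 3 ∧ (G.neighborSet b).ncard = 3

/-- A graph is subcubic if every vertex has degree at most 3. -/
def Subcubic {V : Type} (G : SimpleGraph V) : Prop :=
  ∀ v : V, (G.neighborSet v).ncard ≤ 3

/-- A minimal counterexample: a finite subcubic simple graph with no good coloring such
that every finite subcubic simple graph with smaller `|V| + |E|` has a good coloring. -/
def MinCounter (V : Type) [Finite V] (G : SimpleGraph V) : Prop :=
  Subcubic G ∧
  (¬∃ c : Sym2 V → Fin 8, GoodColoring G c) ∧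
  ∀ (W : Type) [Finite W] (H : SimpleGraph W), Subcubic H →
    Nat.card W + H.edgeSet.ncard < Nat.card V + G.edgeSet.ncard →
    ∃ c : Sym2 W → Fin 8, GoodColoring H c

/-! ### Partial colorings -/

/-- Two unordered pairs share a vertex. -/
def Touch {V : Type} (e f : Sym2 V) : Prop := ∃ a, a ∈ e ∧ a ∈ f

/-- Two unordered pairs share a vertex or are joined by an edge of `G`. -/
def Near {V : Type} (G : SimpleGraph V) (e f : Sym2 V) : Prop :=
  ∃ a ∈ e, ∃ b ∈ f, a = b ∨ G.Adj a b

/-- `c` satisfies the requirements of a good coloring of `G` on the set `F` of edges. -/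
def PartialGood {V : Type} (G : SimpleGraph V) (F : Set (Sym2 V)) (c : Sym2 V → Fin 8) : Prop :=
  (∀ e ∈ F, ∀ f ∈ F, e ≠ f → c e = c f →
    (c e = 0 → ¬Touch e f) ∧ (c e ≠ 0 → ¬Near G e f)) ∧
  ∀ e ∈ F, c e = 0 → ∀ a ∈ e, (G.neighborSet a).ncard = 3

section PartialColorings

variable {V : Type} {G : SimpleGraph V} {F : Set (Sym2 V)} {c : Sym2 V → Fin 8}

theorem Touch.symm {e f : Sym2 V} (h : Touch e f) : Touch f e := by
  obtain ⟨a, h1, h2⟩ := h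
  exact ⟨a, h2, h1⟩

theorem Near.symm {e f : Sym2 V} (h : Near G e f) : Near G f e := by
  obtain ⟨a, h1, b, h2, h3⟩ := h
  exact ⟨b, h2, a, h1, h3.imp Eq.symm fun h => h.symm⟩

theorem Touch.near {e f : Sym2 V} (h : Touch e f) : Near G e f := by
  obtain ⟨a, h1, h2⟩ := h
  exact ⟨a, h1, a, h2, Or.inl rfl⟩

theorem PartialGood.goodColoring (h : PartialGood G G.edgeSet c) : GoodColoring G c := by
  obtain ⟨h1, h2⟩ := h
  refine ⟨⟨?_, ?_⟩, ?_⟩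
  · intro a b x y hab hxy hne h0 h0'
    have := (h1 s(a, b) hab s(x, y) hxy hne (h0.trans h0'.symm)).1 h0
    refine ⟨?_, ?_, ?_, ?_⟩ <;> intro h
    · exact this ⟨a, by simp, by simp [h]⟩
    · exact this ⟨a, by simp, by simp [h]⟩
    · exact this ⟨b, by simp, by simp [h]⟩
    · exact this ⟨b, by simp, by simp [h]⟩
  · intro a b x y hab hxy hne he h0
    have := (h1 s(a, b) hab s(x, y) hxy hne he).2 h0
    refine ⟨⟨?_, ?_, ?_, ?_⟩, ?_, ?_, ?_, ?_⟩ <;> intro h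
    · exact this ⟨a, by simp, x, by simp, Or.inl h⟩
    · exact this ⟨a, by simp, y, by simp, Or.inl h⟩
    · exact this ⟨b, by simp, x, by simp, Or.inl h⟩
    · exact this ⟨b, by simp, y, by simp, Or.inl h⟩
    · exact this ⟨a, by simp, x, by simp, Or.inr h⟩
    · exact this ⟨a, by simp, y, by simp, Or.inr h⟩
    · exact this ⟨b, by simp, x, by simp, Or.inr h⟩
    · exact this ⟨b, by simp, y, by simp, Or.inr h⟩
  · intro a b hab h0
    exact ⟨h2 s(a, b) hab h0 a (by simp), h2 s(a, b) hab h0 b (by simp)⟩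

open Classical in
theorem PartialGood.insert_update (h : PartialGood G F c) {e : Sym2 V} (he : e ∉ F) {k : Fin 8}
    (h3 : k = 0 → ∀ a ∈ e, (G.neighborSet a).ncard = 3)
    (hk : ∀ f ∈ F, c f = k → (k = 0 → ¬Touch e f) ∧ (k ≠ 0 → ¬Near G e f)) :
    PartialGood G (insert e F) (Function.update c e k) := by
  have hu : ∀ f ∈ F, Function.update c e k f = c f := fun f hf =>
    Function.update_of_ne (by rintro rfl; exact he hf) _ _
  refine ⟨?_, ?_⟩
  · rintro x (rfl | hx) y (rfl | hy) hne hc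
    · exact absurd rfl hne
    · rw [hu y hy, Function.update_self] at hc
      rw [Function.update_self]
      exact hk y hy hc.symm
    · rw [hu x hx, Function.update_self] at hc
      rw [hu x hx, hc]
      have := hk x hx hc
      exact ⟨fun h0 ht => this.1 h0 ht.symm, fun h0 ht => this.2 h0 ht.symm⟩
    · rw [hu x hx, hu y hy] at hc
      rw [hu x hx]
      exact h.1 x hx y hy hne hc
  · rintro x (rfl | hx) h0 a ha
    · rw [Function.update_self] at h0
      exact h3 h0 a ha
    · rw [hu x hx] at h0
      exact h.2 x hx h0 a ha

open Classical in
theorem PartialGood.update_zero (h : PartialGood G F c) {e : Sym2 V}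
    (h3 : ∀ a ∈ e, (G.neighborSet a).ncard = 3)
    (hk : ∀ f ∈ F, f ≠ e → c f = 0 → ¬Touch e f) :
    PartialGood G F (Function.update c e 0) := by
  refine ⟨?_, ?_⟩
  · intro x hx y hy hne hc
    by_cases hxe : x = e
    · subst hxe
      rw [Function.update_self, Function.update_of_ne hne.symm] at hc
      rw [Function.update_self]
      exact ⟨fun _ => hk y hy hne.symm hc.symm, fun h => absurd rfl h⟩
    · rw [Function.update_of_ne hxe] at hc ⊢
      by_cases hye : y = e
      · subst hye
        rw [Function.update_self] at hc
        exact ⟨fun _ ht => hk x hx hne hc ht.symm, fun h => absurd hc h⟩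
      · rw [Function.update_of_ne hye] at hc
        exact h.1 x hx y hy hne hc
  · intro x hx h0 a ha
    by_cases hxe : x = e
    · subst hxe
      exact h3 a ha
    · rw [Function.update_of_ne hxe] at h0
      exact h.2 x hx h0 a ha

theorem PartialGood.comp_perm (h : PartialGood G F c) (σ : Equiv.Perm (Fin 8)) (h0 : σ 0 = 0) :
    PartialGood G F (fun e => σ (c e)) := by
  have hz : ∀ k, σ k = 0 ↔ k = 0 := fun k =>
    ⟨fun hk => σ.injective (hk.trans h0.symm), fun hk => hk ▸ h0⟩
  refine ⟨?_, ?_⟩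
  · intro x hx y hy hne hc
    have := h.1 x hx y hy hne (σ.injective hc)
    simpa only [ne_eq, hz] using this
  · intro x hx hx0
    exact h.2 x hx ((hz _).1 hx0)

/-- At a vertex `v` the colors of distinct edges differ unless they are `0`. -/
theorem PartialGood.ne_of_touch (h : PartialGood G F c) {e f : Sym2 V} (he : e ∈ F) (hf : f ∈ F)
    (hne : e ≠ f) (ht : Touch e f) : c e ≠ c f := by
  intro hc
  by_cases h0 : c e = 0
  · exact (h.1 e he f hf hne hc).1 h0 ht
  · exact (h.1 e he f hf hne hc).2 h0 ht.near

end PartialColorings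

/-! ### The coloring game

A finite configuration is a list of keys `(i, j)`; a key with `i = j` stands for the edge leaving
the configuration at vertex `i`, a key with `i ≠ j` for the edge joining vertices `i` and `j`.
A state stores, for every uncolored key, the set of its available colors as one byte. -/

/-- Two keys have a common index. -/
def share (e f : ℕ × ℕ) : Bool := e.1 == f.1 || e.1 == f.2 || e.2 == f.1 || e.2 == f.2

/-- The vertices `i` and `j` of the configuration with edge list `E` are adjacent. -/
def joined (E : List (ℕ × ℕ)) (i j : ℕ) : Bool := E.contains (i, j) || E.contains (j, i)

/-- Two keys may not receive the same nonzero color. Two leaving edges always conflict,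
unless `q` holds at both. -/
def conf (E : List (ℕ × ℕ)) (q : ℕ → Bool) (e f : ℕ × ℕ) : Bool :=
  share e f || joined E e.1 f.1 || joined E e.1 f.2 || joined E e.2 f.1 || joined E e.2 f.2 ||
    (e.1 == e.2 && f.1 == f.2 && !(q e.1 && q f.1))

/-- Concatenate bytes, the head being the least significant. -/
def pack : List ℕ → ℕ
  | [] => 0
  | b :: l => 2 ^ 8 * pack l + b

/-- The mask that removes color `k` from the keys of `l` satisfying `p`. -/
def clearMask (p : ℕ × ℕ → Bool) (l : List (ℕ × ℕ)) (k : ℕ) : ℕ :=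
  Nat.xor (2 ^ (8 * l.length) - 1) (Nat.shiftLeft (pack (l.map fun f => bif p f then 1 else 0)) k)

/-- The application `f s`, arranged such that the kernel evaluates `s` first. -/
def force (s : ℕ) (f : ℕ → Bool) : Bool := Nat.rec (f 0) (fun k _ => f k) (Nat.add s 1)

/-- The data for one round of the game: one less than the number of colors that have to work and
the number of colors that may fail, the constants for recognizing states with an empty byte, the
mask for color `0`, and the bits and masks of the other colors. -/
abbrev Round := (ℕ × ℕ) × (ℕ × ℕ) × ℕ × List (ℕ × ℕ)

/-- The bits and masks of the colors `k, …, 1`, followed by `L`. -/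
def masks (p : ℕ × ℕ → Bool) (l : List (ℕ × ℕ)) : ℕ → List (ℕ × ℕ) → List (ℕ × ℕ)
  | 0, L => L
  | k + 1, L => masks p l k ((2 ^ (k + 1), clearMask p l (k + 1)) :: L)

/-- The rounds of the game on a list of keys. -/
def rounds (E : List (ℕ × ℕ)) (q : ℕ → Bool) (wt : ℕ × ℕ → ℕ × ℕ) : List (ℕ × ℕ) → List Round
  | [] => []
  | e :: l => (((wt e).1 - 1, (wt e).2),
      (2 ^ (8 * l.length) - pack (l.map fun _ => 1), pack (l.map fun _ => 2 ^ 7)),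
      clearMask (share e) l 0, masks (conf E q e) l 7 []) :: rounds E q wt l

/-- Apply `F` to the evaluated bits and masks. -/
def withMasks (p : ℕ × ℕ → Bool) (l : List (ℕ × ℕ)) (F : List (ℕ × ℕ) → Bool) (n : ℕ) :
    List (ℕ × ℕ) → Bool :=
  Nat.rec F (fun k ih L => force (2 ^ (k + 1)) fun b => force (clearMask p l (k + 1)) fun m =>
    ih ((b, m) :: L)) n

/-- Apply `F` to the evaluated rounds. -/
def withRounds (E : List (ℕ × ℕ)) (q : ℕ → Bool) (wt : ℕ × ℕ → ℕ × ℕ) (L : List (ℕ × ℕ)) :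
    (List Round → Bool) → Bool :=
  List.rec (fun F => F []) (fun e l ih F =>
    force ((wt e).1 - 1) fun need => force (wt e).2 fun allow =>
    force (2 ^ (8 * l.length) - pack (l.map fun _ => 1)) fun low =>
    force (pack (l.map fun _ => 2 ^ 7)) fun high => force (clearMask (share e) l 0) fun m =>
    withMasks (conf E q e) l
      (fun M => ih fun R => F (((need, allow), (low, high), m, M) :: R)) 7 []) L

/-- At least `need + 1` entries of the list satisfy `good`; gives up after more than `allow`
failures. -/
def manyGood {α : Type} (good : α → Bool) (l : List α) : ℕ → ℕ → Bool :=
  List.rec (fun _ _ => false) (fun a _ ih need allow => Bool.rec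
    (Nat.rec false (fun allow' _ => ih need allow') allow)
    (Nat.rec true (fun need' _ => ih need' allow) need) (good a)) l

/-- Every byte of the state `s` is nonzero. -/
def alive (s : ℕ) (c : ℕ × ℕ) : Bool :=
  Nat.beq (Nat.land (Nat.add s c.1) (Nat.xor (Nat.land s c.2) c.2)) 0

/-- Play the color with the given bit and mask in the state `s`. -/
def play (next : ℕ → Bool) (c : ℕ × ℕ) (s b m : ℕ) : Bool :=
  Bool.rec (force (Nat.land (Nat.shiftRight s 8) m) fun t => Bool.rec false (next t) (alive t c))
    false (Nat.beq (Nat.land s b) 0)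

/-- The game is won from the given state, whatever colors get forbidden during the game. -/
def game (L : List Round) : ℕ → Bool :=
  List.rec (fun _ => true) (fun r _ ih s => Bool.rec
    (manyGood (fun p => play ih r.2.1 s p.1 p.2) r.2.2.2 r.1.1 r.1.2) true
    (play ih r.2.1 s 1 r.2.2.1)) L

section Game

theorem testBit_pack (l : List ℕ) (hl : ∀ b ∈ l, b < 2 ^ 8) (i : ℕ) (hi : i < l.length) (k : ℕ)
    (hk : k < 8) : (pack l).testBit (8 * i + k) = (l[i]).testBit k := by
  induction l generalizing i with
  | nil => simp at hi
  | cons b l ih =>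
    rw [pack, Nat.testBit_two_pow_mul_add _ (hl b (by simp))]
    cases i with
    | zero => simp [hk]
    | succ i =>
      rw [if_neg (by omega), show 8 * (i + 1) + k - 8 = 8 * i + k by omega]
      simpa using ih (fun b hb => hl b (by simp [hb])) i (by simpa using hi)

theorem not_of_testBit_clearMask {p : ℕ × ℕ → Bool} {l : List (ℕ × ℕ)} {k i : ℕ}
    (hi : i < l.length) (hk : k < 8) (h : (clearMask p l k).testBit (8 * i + k) = true) :
    p l[i] = false := by
  have h1 : (pack (l.map fun f => bif p f then 1 else 0)).testBit (8 * i + 0) = p l[i] := by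
    rw [testBit_pack _ _ i (by simpa using hi) 0 (by omega)]
    · rw [List.getElem_map]
      cases p l[i] <;> rfl
    · intro b hb
      obtain ⟨f, -, rfl⟩ := List.mem_map.1 hb
      cases p f <;> decide
  change ((2 ^ (8 * l.length) - 1) ^^^ ((pack (l.map fun f => bif p f then 1 else 0))
    <<< k)).testBit
    (8 * i + k) = true at h
  rw [Nat.testBit_xor, Nat.testBit_two_pow_sub_one, Nat.testBit_shiftLeft,
    show 8 * i + k - k = 8 * i + 0 by omega, h1,
      decide_eq_true (by omega : 8 * i + k < 8 * l.length),
    decide_eq_true (by omega : 8 * i + k ≥ k)] at h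
  simpa using h

theorem testBit_shiftRight_land {s m i k : ℕ}
    (h : (Nat.land (Nat.shiftRight s 8) m).testBit (8 * i + k) = true) :
    s.testBit (8 * (i + 1) + k) = true ∧ m.testBit (8 * i + k) = true := by
  change ((s >>> 8) &&& m).testBit (8 * i + k) = true at h
  rw [Nat.testBit_land, Nat.testBit_shiftRight, Bool.and_eq_true] at h
  exact ⟨by rw [← h.1]; congr 1; omega, h.2⟩

theorem testBit_of_beq_land {s k : ℕ} (h : Nat.beq (Nat.land s (2 ^ k)) 0 = false) :
    s.testBit k = true := by
  change Nat.beq (s &&& 2 ^ k) 0 = false at h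
  rw [Nat.and_two_pow] at h
  cases hs : s.testBit k
  · simp [hs] at h
  · rfl

theorem force_eq (s : ℕ) (f : ℕ → Bool) : force s f = f s := by
  cases s <;> rfl

theorem withMasks_eq (p : ℕ × ℕ → Bool) (l : List (ℕ × ℕ)) (F : List (ℕ × ℕ) → Bool) (n : ℕ)
    (L : List (ℕ × ℕ)) : withMasks p l F n L = F (masks p l n L) := by
  induction n generalizing L with
  | zero => rfl
  | succ n ih => exact ih _

theorem withRounds_cons (E : List (ℕ × ℕ)) (q : ℕ → Bool) (wt : ℕ × ℕ → ℕ × ℕ) (e : ℕ × ℕ)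
    (L : List (ℕ × ℕ)) (F : List Round → Bool) : withRounds E q wt (e :: L) F =
      withMasks (conf E q e) L (fun M => withRounds E q wt L fun R =>
        F ((((wt e).1 - 1, (wt e).2), (2 ^ (8 * L.length) - pack (L.map fun _ => 1),
          pack (L.map fun _ => 2 ^ 7)), clearMask (share e) L 0, M) :: R)) 7 [] := by
  simp only [withRounds, force_eq]

theorem withRounds_eq (E : List (ℕ × ℕ)) (q : ℕ → Bool) (wt : ℕ × ℕ → ℕ × ℕ) (L : List (ℕ × ℕ))
    (F : List Round → Bool) : withRounds E q wt L F = F (rounds E q wt L) := by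
  induction L generalizing F with
  | nil => rfl
  | cons e l ih =>
    rw [withRounds_cons, withMasks_eq, ih, rounds]

theorem masks_eq (p : ℕ × ℕ → Bool) (l : List (ℕ × ℕ)) (n : ℕ) (L : List (ℕ × ℕ)) :
    masks p l n L = (List.range' 1 n).map (fun k => (2 ^ k, clearMask p l k)) ++ L := by
  induction n generalizing L with
  | zero => rfl
  | succ n ih =>
    rw [masks, ih, List.range'_concat, List.map_append, List.append_assoc]
    simp [add_comm]

theorem lt_length_of_manyGood {α : Type} {good : α → Bool} {l : List α} {need allow : ℕ}
    (h : manyGood good l need allow = true) : need < (l.filter good).length := by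
  induction l generalizing need allow with
  | nil => exact absurd h (by simp [manyGood])
  | cons a l ih =>
    cases ha : good a
    · rw [List.filter_cons_of_neg (by simp [ha])]
      rw [manyGood] at h
      simp only [ha] at h
      cases allow with
      | zero => exact absurd h (by simp)
      | succ allow => exact ih h
    · rw [List.filter_cons_of_pos ha, List.length_cons]
      rw [manyGood] at h
      simp only [ha] at h
      cases need with
      | zero => exact Nat.succ_pos _
      | succ need => exact Nat.succ_lt_succ (ih h)

theorem of_play {next : ℕ → Bool} {c : ℕ × ℕ} {s k m : ℕ} (h : play next c s (2 ^ k) m = true) :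
    s.testBit k = true ∧ next (Nat.land (Nat.shiftRight s 8) m) = true := by
  rw [play, force_eq] at h
  generalize ha : alive (Nat.land (Nat.shiftRight s 8) m) c = a at h
  generalize hb : Nat.beq (Nat.land s (2 ^ k)) 0 = b at h
  cases b
  · cases a
    · exact absurd h Bool.false_ne_true
    · exact ⟨testBit_of_beq_land hb, h⟩
  · exact absurd h Bool.false_ne_true

/-- One round of the game: either color `0` works, or sufficiently many other colors do. -/
theorem game_cons {E : List (ℕ × ℕ)} {q : ℕ → Bool} {wt : ℕ × ℕ → ℕ × ℕ} {e : ℕ × ℕ}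
    {l : List (ℕ × ℕ)} {s : ℕ} (h : game (rounds E q wt (e :: l)) s = true) :
    (s.testBit 0 = true ∧ game (rounds E q wt l)
      (Nat.land (Nat.shiftRight s 8) (clearMask (share e) l 0)) = true) ∨
    ∃ K : Finset ℕ, (wt e).1 ≤ K.card ∧ ∀ k ∈ K, 0 < k ∧ k < 8 ∧ s.testBit k = true ∧
      game (rounds E q wt l)
        (Nat.land (Nat.shiftRight s 8) (clearMask (conf E q e) l k)) = true := by
  rw [rounds] at h
  obtain ⟨c, hc⟩ : ∃ c, c = (2 ^ (8 * l.length) - pack (l.map fun _ => 1),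
    pack (l.map fun _ => 2 ^ 7)) := ⟨_, rfl⟩
  rw [← hc] at h
  change Bool.rec (manyGood (fun p => play (game (rounds E q wt l)) c s p.1 p.2)
    (masks (conf E q e) l 7 []) ((wt e).1 - 1) (wt e).2) true
    (play (game (rounds E q wt l)) c s (2 ^ 0) (clearMask (share e) l 0)) = true at h
  cases hz : play (game (rounds E q wt l)) c s (2 ^ 0) (clearMask (share e) l 0)
  · right
    rw [hz] at h
    have := lt_length_of_manyGood (show manyGood _ _ _ _ = true from h)
    rw [masks_eq, List.append_nil, List.filter_map, List.length_map] at this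
    refine ⟨_, (Nat.le_of_pred_lt this).trans (List.toFinset_card_of_nodup
      (List.Nodup.filter _ (List.nodup_range' (s := 1) (n := 7)))).ge, ?_⟩
    intro k hk
    rw [List.mem_toFinset, List.mem_filter, List.mem_range'_1, Function.comp_apply] at hk
    exact ⟨hk.1.1, by omega, of_play hk.2⟩
  · exact Or.inl (of_play hz)

end Game

/-! ### Recoloring at an outer vertex -/

section Recolor

variable {V : Type} {G : SimpleGraph V} {F O : Set (Sym2 V)} {c : Sym2 V → Fin 8}
  {v w w' : V}

/-- The nonzero colors of the edges in `O` at `w` that do not lead to `v`. -/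
def sideColors (G : SimpleGraph V) (O : Set (Sym2 V)) (c : Sym2 V → Fin 8) (v w : V) :
    Set (Fin 8) :=
  (fun x => c s(w, x)) '' {x | G.Adj w x ∧ x ≠ v ∧ s(w, x) ∈ O ∧ c s(w, x) ≠ 0}

theorem mem_sideColors (hOG : O ⊆ G.edgeSet) {f : Sym2 V} (hf : f ∈ O) (hw : w ∈ f) (hv : v ∉ f)
    (h0 : c f ≠ 0) : c f ∈ sideColors G O c v w := by
  obtain ⟨x, rfl⟩ := hw
  refine ⟨x, ⟨hOG hf, ?_, hf, h0⟩, rfl⟩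
  rintro rfl
  exact hv (by simp)

theorem ncard_sideColors_le_two [Finite V] (hG : Subcubic G) (hvw : G.Adj v w) :
    (sideColors G O c v w).ncard ≤ 2 := by
  refine (Set.ncard_image_le (Set.toFinite _)).trans ?_
  have h1 : {x | G.Adj w x ∧ x ≠ v ∧ s(w, x) ∈ O ∧ c s(w, x) ≠ 0} ⊆ G.neighborSet w \ {v} :=
    fun x hx => ⟨hx.1, hx.2.1⟩
  have h2 := Set.ncard_le_ncard h1 (Set.toFinite _)
  rw [Set.ncard_sdiff_singleton_of_mem (by exact hvw.symm)] at h2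
  have := hG w
  omega

theorem ncard_sideColors_le_one [Finite V] (hG : Subcubic G) (hvw : G.Adj v w)
    (h : (G.neighborSet w).ncard ≠ 3 ∨
      ∃ y, G.Adj w y ∧ y ≠ v ∧ (s(w, y) ∉ O ∨ c s(w, y) = 0)) :
    (sideColors G O c v w).ncard ≤ 1 := by
  refine (Set.ncard_image_le (Set.toFinite _)).trans ?_
  have hd := hG w
  have hm : v ∈ G.neighborSet w := hvw.symm
  rcases h with h | ⟨y, hy, hyv, h⟩
  · have h1 : {x | G.Adj w x ∧ x ≠ v ∧ s(w, x) ∈ O ∧ c s(w, x) ≠ 0} ⊆ G.neighborSet w \ {v} :=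
      fun x hx => ⟨hx.1, hx.2.1⟩
    have h2 := Set.ncard_le_ncard h1 (Set.toFinite _)
    rw [Set.ncard_sdiff_singleton_of_mem hm] at h2
    omega
  · have h1 : {x | G.Adj w x ∧ x ≠ v ∧ s(w, x) ∈ O ∧ c s(w, x) ≠ 0} ⊆
        (G.neighborSet w \ {v}) \ {y} := by
      rintro x ⟨hx1, hx2, hx3, hx4⟩
      refine ⟨⟨hx1, hx2⟩, ?_⟩
      rintro rfl
      rcases h with h | h
      · exact h hx3
      · exact hx4 h
    have h2 := Set.ncard_le_ncard h1 (Set.toFinite _)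
    rw [Set.ncard_sdiff_singleton_of_mem (show y ∈ G.neighborSet w \ {v} from ⟨hy, hyv⟩),
      Set.ncard_sdiff_singleton_of_mem hm] at h2
    omega

/-- An outer vertex `v` of degree 3 with two outer neighbors, all of whose colored edges have
nonzero colors, admits all but four nonzero colors on its remaining edge, after possibly giving
color `0` to an edge at `v` that avoids the set `B`. -/
theorem exists_recolor [Finite V] (hG : Subcubic G) (hOF : O ⊆ F) (hFG : F ⊆ G.edgeSet)
    (hc : PartialGood G F c) (hd : (G.neighborSet v).ncard = 3) (hne : w ≠ w')
    (hw : s(v, w) ∈ O) (hw' : s(v, w') ∈ O)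
    (hv : ∀ f ∈ F, v ∈ f → f = s(v, w) ∨ f = s(v, w')) (hz : c s(v, w) ≠ 0) (hz' : c s(v, w') ≠ 0)
    (B : Set V) (hvB : v ∉ B) (hB : ∀ x ∈ B, ∃ y, G.Adj x y ∧ y ≠ v ∧ s(x, y) ∉ O) :
    ∃ Y : Set (Fin 8), Y.ncard ≤ 4 ∧ ∀ p, p ≠ 0 → p ∉ Y → ∃ c' : Sym2 V → Fin 8,
      PartialGood G F c' ∧ (∀ f, c' f ≠ c f → c' f = 0 ∧ f ∈ O ∧ v ∈ f ∧ ∀ x ∈ B, x ∉ f) ∧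
      ∀ f ∈ O, v ∈ f ∨ w ∈ f ∨ w' ∈ f → c' f ≠ p := by
  classical
  have hav : G.Adj v w := hFG (hOF hw)
  have hav' : G.Adj v w' := hFG (hOF hw')
  have hab : c s(v, w) ≠ c s(v, w') :=
    hc.ne_of_touch (hOF hw) (hOF hw') (by simp [hne, hav.ne']) ⟨v, by simp, by simp⟩
  have hOG := hOF.trans hFG
  let Free : V → Prop := fun x => x ∉ B ∧ (G.neighborSet x).ncard = 3 ∧ ∀ f ∈ F, x ∈ f → c f ≠ 0
  have hnf : ∀ x, G.Adj v x → c s(v, x) ≠ 0 → ¬Free x → (sideColors G O c v x).ncard ≤ 1 := by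
    intro x hvx hzx hx
    apply ncard_sideColors_le_one hG hvx
    by_contra! h
    refine hx ⟨fun hxB => ?_, h.1, ?_⟩
    · obtain ⟨y, hy1, hy2, hy3⟩ := hB x hxB
      exact hy3 (h.2 y hy1 hy2).1
    · rintro f hf ⟨y, rfl⟩
      by_cases hyv : y = v
      · subst hyv
        rwa [Sym2.eq_swap]
      · exact (h.2 y (hFG hf) hyv).2
  have hfr : ∀ x, G.Adj v x → Free x → PartialGood G F (Function.update c s(v, x) 0) := by
    intro x hvx hx
    refine hc.update_zero ?_ ?_
    · intro a ha
      rcases Sym2.mem_iff.1 ha with rfl | rfl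
      · exact hd
      · exact hx.2.1
    · rintro f hf - h0 ⟨a, ha, haf⟩
      rcases Sym2.mem_iff.1 ha with rfl | rfl
      · rcases hv f hf haf with rfl | rfl
        · exact hz h0
        · exact hz' h0
      · exact hx.2.2 f hf haf h0
  have hch : ∀ x, s(v, x) ∈ O → Free x → ∀ f, Function.update c s(v, x) 0 f ≠ c f →
      Function.update c s(v, x) 0 f = 0 ∧ f ∈ O ∧ v ∈ f ∧ ∀ y ∈ B, y ∉ f := by
    intro x hvx hx f hf
    by_cases hfe : f = s(v, x)
    · subst hfe
      refine ⟨Function.update_self .., hvx, by simp, fun y hy hyf => ?_⟩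
      rcases Sym2.mem_iff.1 hyf with rfl | rfl
      · exact hvB hy
      · exact hx.1 hy
    · exact absurd (Function.update_of_ne hfe _ _) hf
  have hfar : ∀ (p : Fin 8) (c' : Sym2 V → Fin 8), p ≠ 0 → p ∉ sideColors G O c v w →
      p ∉ sideColors G O c v w' → (∀ f, v ∉ f → c' f = c f) → c' s(v, w) ≠ p → c' s(v, w') ≠ p →
      ∀ f ∈ O, v ∈ f ∨ w ∈ f ∨ w' ∈ f → c' f ≠ p := by
    intro p c' hp h1 h2 h3 h4 h5 f hf h
    by_cases hvf : v ∈ f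
    · rcases hv f (hOF hf) hvf with rfl | rfl
      · exact h4
      · exact h5
    · rw [h3 f hvf]
      rintro rfl
      rcases h with h | h | h
      · exact hvf h
      · exact h1 (mem_sideColors hOG hf h hvf hp)
      · exact h2 (mem_sideColors hOG hf h hvf hp)
  have hup : ∀ x, ∀ f, v ∉ f → Function.update c s(v, x) 0 f = c f := fun x f hf =>
    Function.update_of_ne (by rintro rfl; exact hf (by simp)) _ _
  have hs : s(v, w) ≠ s(v, w') := fun h => hab (congrArg c h)
  have h2w := ncard_sideColors_le_two (O := O) (c := c) hG hav
  have h2w' := ncard_sideColors_le_two (O := O) (c := c) hG hav'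
  have hU := Set.ncard_union_le (sideColors G O c v w) (sideColors G O c v w')
  by_cases h : Free w <;> by_cases h' : Free w'
  · refine ⟨_, hU.trans (by omega), fun p hp hpY => ?_⟩
    rw [Set.mem_union, not_or] at hpY
    by_cases hpb : c s(v, w') = p
    · refine ⟨_, hfr w' hav' h', hch w' hw' h', hfar p _ hp hpY.1 hpY.2 (hup w') ?_ ?_⟩
      · rw [Function.update_of_ne hs]
        exact hpb ▸ hab
      · rw [Function.update_self]
        exact hp.symm
    · refine ⟨_, hfr w hav h, hch w hw h, hfar p _ hp hpY.1 hpY.2 (hup w) ?_ ?_⟩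
      · rw [Function.update_self]
        exact hp.symm
      · rwa [Function.update_of_ne hs.symm]
  · have h1 := hnf w' hav' hz' h'
    refine ⟨insert (c s(v, w')) (sideColors G O c v w ∪ sideColors G O c v w'),
      (Set.ncard_insert_le _ _).trans (by omega), fun p hp hpY => ?_⟩
    rw [Set.mem_insert_iff, Set.mem_union, not_or, not_or] at hpY
    refine ⟨_, hfr w hav h, hch w hw h, hfar p _ hp hpY.2.1 hpY.2.2 (hup w) ?_ ?_⟩
    · rw [Function.update_self]
      exact hp.symm
    · rw [Function.update_of_ne hs.symm]
      exact Ne.symm hpY.1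
  · have h1 := hnf w hav hz h
    refine ⟨insert (c s(v, w)) (sideColors G O c v w ∪ sideColors G O c v w'),
      (Set.ncard_insert_le _ _).trans (by omega), fun p hp hpY => ?_⟩
    rw [Set.mem_insert_iff, Set.mem_union, not_or, not_or] at hpY
    refine ⟨_, hfr w' hav' h', hch w' hw' h', hfar p _ hp hpY.2.1 hpY.2.2 (hup w') ?_ ?_⟩
    · rw [Function.update_of_ne hs]
      exact Ne.symm hpY.1
    · rw [Function.update_self]
      exact hp.symm
  · have h1 := hnf w hav hz h
    have h1' := hnf w' hav' hz' h'
    refine ⟨_, (Set.ncard_insert_le (c s(v, w)) _).trans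
      (Nat.succ_le_succ ((Set.ncard_insert_le (c s(v, w')) _).trans (Nat.succ_le_succ
        (hU.trans (Nat.add_le_add h1 h1'))))), fun p hp hpY => ?_⟩
    rw [Set.mem_insert_iff, Set.mem_insert_iff, Set.mem_union, not_or, not_or, not_or] at hpY
    exact ⟨c, hc, fun f hf => absurd rfl hf, hfar p c hp hpY.2.2.1 hpY.2.2.2 (fun _ _ => rfl)
      (Ne.symm hpY.1) (Ne.symm hpY.2.1)⟩

end Recolor

/-! ### Configurations -/

/-- The vertices `u 0, …, u (n - 1)` of `G` induce the graph with edge list `E`, and each `u i` has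
at most one further neighbor `v i`, these being distinct. The status `st i` is `0` or `1` if `v i`
exists and has degree `3` or at most `2`, respectively, and it is `2` if there is no `v i`. If `fl`
holds, then the vertices `v i` of degree at most `2` are pairwise nonadjacent. -/
structure Config {V : Type} (G : SimpleGraph V) (n : ℕ) (E : List (ℕ × ℕ)) (fl : Bool)
    (st : ℕ → ℕ) (u v : ℕ → V) : Prop where
  lt : ∀ e ∈ E, e.1 < e.2 ∧ e.2 < n
  inj : ∀ i < n, ∀ j < n, u i = u j → i = j
  adj : ∀ i < n, ∀ j < n, G.Adj (u i) (u j) ↔ joined E i j = true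
  nbr : ∀ i < n, ∀ x, G.Adj (u i) x → (∃ j < n, x = u j) ∨ (st i ≠ 2 ∧ x = v i)
  leave : ∀ i < n, st i ≠ 2 → G.Adj (u i) (v i)
  outside : ∀ i < n, st i ≠ 2 → ∀ j < n, v i ≠ u j
  vinj : ∀ i < n, ∀ j < n, st i ≠ 2 → st j ≠ 2 → v i = v j → i = j
  st_le : ∀ i < n, st i ≤ 2
  deg_eq : ∀ i < n, st i = 0 → (G.neighborSet (v i)).ncard = 3
  deg_le : ∀ i < n, st i = 1 → (G.neighborSet (v i)).ncard ≤ 2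
  indep : fl = true → ∀ i < n, ∀ j < n, st i = 1 → st j = 1 → ¬G.Adj (v i) (v j)

/-- The edge of `G` described by a key. -/
def edgeOf {V : Type} (u v : ℕ → V) (e : ℕ × ℕ) : Sym2 V :=
  if e.1 = e.2 then s(u e.1, v e.1) else s(u e.1, u e.2)

/-- The keys of a configuration. -/
def IsKey (n : ℕ) (E : List (ℕ × ℕ)) (st : ℕ → ℕ) (e : ℕ × ℕ) : Prop :=
  e ∈ E ∨ e.1 = e.2 ∧ e.1 < n ∧ st e.1 ≠ 2

/-- The edges of `G` that avoid the configuration. -/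
def outer {V : Type} (G : SimpleGraph V) (n : ℕ) (u : ℕ → V) : Set (Sym2 V) :=
  {e | e ∈ G.edgeSet ∧ ∀ i < n, u i ∉ e}

/-- The pairs of leaving edges that need not conflict. -/
def lax (fl : Bool) (st : ℕ → ℕ) (i : ℕ) : Bool := fl && st i == 1

theorem joined_iff {E : List (ℕ × ℕ)} {i j : ℕ} :
    joined E i j = true ↔ (i, j) ∈ E ∨ (j, i) ∈ E := by
  simp [joined]

theorem joined_comm (E : List (ℕ × ℕ)) (i j : ℕ) : joined E i j = joined E j i :=
  Bool.or_comm _ _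

theorem share_iff {e f : ℕ × ℕ} : share e f = true ↔
    e.1 = f.1 ∨ e.1 = f.2 ∨ e.2 = f.1 ∨ e.2 = f.2 := by
  simp [share, or_assoc]

theorem conf_of_share {E : List (ℕ × ℕ)} {q : ℕ → Bool} {e f : ℕ × ℕ} (h : share e f = true) :
    conf E q e f = true := by
  simp [conf, h]

theorem conf_of_joined {E : List (ℕ × ℕ)} {q : ℕ → Bool} {e f : ℕ × ℕ}
    (h : joined E e.1 f.1 = true ∨ joined E e.1 f.2 = true ∨ joined E e.2 f.1 = true ∨
      joined E e.2 f.2 = true) : conf E q e f = true := by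
  rcases h with h | h | h | h <;> simp [conf, h]

section Configurations

variable {V : Type} {G : SimpleGraph V} {n : ℕ} {E : List (ℕ × ℕ)} {fl : Bool} {st : ℕ → ℕ}
  {u v : ℕ → V}

theorem edgeOf_self (i : ℕ) : edgeOf u v (i, i) = s(u i, v i) := if_pos rfl

theorem edgeOf_of_ne {e : ℕ × ℕ} (h : e.1 ≠ e.2) : edgeOf u v e = s(u e.1, u e.2) := if_neg h

theorem outer_subset : outer G n u ⊆ G.edgeSet := fun _ h => h.1

theorem IsKey.cases (C : Config G n E fl st u v) {e : ℕ × ℕ} (h : IsKey n E st e) :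
    (e ∈ E ∧ e.1 < n ∧ e.2 < n ∧ e.1 ≠ e.2 ∧ edgeOf u v e = s(u e.1, u e.2)) ∨
      ∃ i < n, st i ≠ 2 ∧ e = (i, i) ∧ edgeOf u v e = s(u i, v i) := by
  rcases h with h | ⟨h1, h2, h3⟩
  · have := C.lt e h
    exact Or.inl ⟨h, by omega, by omega, by omega, if_neg (by omega)⟩
  · exact Or.inr ⟨e.1, h2, h3, Prod.ext rfl h1.symm, if_pos h1⟩

theorem Config.edgeOf_mem (C : Config G n E fl st u v) {e : ℕ × ℕ} (h : IsKey n E st e) :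
    edgeOf u v e ∈ G.edgeSet := by
  rcases h.cases C with ⟨h, h1, h2, -, he⟩ | ⟨i, hi, hst, -, he⟩
  · rw [he]
    exact (C.adj _ h1 _ h2).2 (joined_iff.2 (Or.inl h))
  · rw [he]
    exact C.leave i hi hst

theorem Config.edgeOf_notMem_outer (C : Config G n E fl st u v) {e : ℕ × ℕ}
    (h : IsKey n E st e) : edgeOf u v e ∉ outer G n u := by
  rintro ⟨-, h0⟩
  rcases h.cases C with ⟨h, h1, h2, -, he⟩ | ⟨i, hi, hst, -, he⟩
  · exact h0 _ h1 (by simp [he])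
  · exact h0 i hi (by simp [he])

theorem Config.edgeOf_inj (C : Config G n E fl st u v) {e f : ℕ × ℕ} (he : IsKey n E st e)
    (hf : IsKey n E st f) (h : edgeOf u v e = edgeOf u v f) : e = f := by
  rcases he.cases C with ⟨h1, h2, h3, h4, h5⟩ | ⟨i, hi, hst, h4, h5⟩ <;>
    rcases hf.cases C with ⟨k1, k2, k3, k4, k5⟩ | ⟨j, hj, hst', k4, k5⟩ <;>
    rw [h5, k5, Sym2.eq_iff] at h
  · rcases h with ⟨h, h'⟩ | ⟨h, h'⟩
    · exact Prod.ext (C.inj _ h2 _ k2 h) (C.inj _ h3 _ k3 h')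
    · have := C.inj _ h2 _ k3 h
      have := C.inj _ h3 _ k2 h'
      have := C.lt _ h1
      have := C.lt _ k1
      omega
  · rcases h with ⟨-, h⟩ | ⟨h, -⟩
    · exact absurd h.symm (C.outside j hj hst' _ h3)
    · exact absurd h.symm (C.outside j hj hst' _ h2)
  · rcases h with ⟨-, h⟩ | ⟨-, h⟩
    · exact absurd h (C.outside i hi hst _ k3)
    · exact absurd h (C.outside i hi hst _ k2)
  · rcases h with ⟨h, -⟩ | ⟨h, -⟩
    · rw [h4, k4, C.inj i hi j hj h]
    · exact absurd h.symm (C.outside j hj hst' i hi)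

theorem Config.mem_outer_or (C : Config G n E fl st u v) {f : Sym2 V} (hf : f ∈ G.edgeSet) :
    f ∈ outer G n u ∨ ∃ e, IsKey n E st e ∧ f = edgeOf u v e := by
  by_cases h : ∀ i < n, u i ∉ f
  · exact Or.inl ⟨hf, h⟩
  · right
    push Not at h
    obtain ⟨i, hi, x, rfl⟩ := h
    rcases C.nbr i hi x hf with ⟨j, hj, rfl⟩ | ⟨hst, rfl⟩
    · rcases joined_iff.1 ((C.adj i hi j hj).1 hf) with h | h
      · exact ⟨_, Or.inl h, (edgeOf_of_ne (C.lt _ h).1.ne).symm⟩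
      · exact ⟨_, Or.inl h, Sym2.eq_swap.trans (edgeOf_of_ne (C.lt _ h).1.ne).symm⟩
    · exact ⟨(i, i), Or.inr ⟨rfl, hi, hst⟩, (edgeOf_self i).symm⟩

/-- An endpoint of the edge of a key. -/
theorem IsKey.mem_edgeOf (C : Config G n E fl st u v) {e : ℕ × ℕ} (h : IsKey n E st e) {x : V}
    (hx : x ∈ edgeOf u v e) :
    (∃ i < n, x = u i ∧ (i = e.1 ∨ i = e.2)) ∨ ∃ i < n, st i ≠ 2 ∧ e = (i, i) ∧ x = v i := by
  rcases h.cases C with ⟨h1, h2, h3, h4, h5⟩ | ⟨i, hi, hst, h4, h5⟩ <;>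
    rcases Sym2.mem_iff.1 (h5 ▸ hx) with rfl | rfl
  · exact Or.inl ⟨_, h2, rfl, Or.inl rfl⟩
  · exact Or.inl ⟨_, h3, rfl, Or.inr rfl⟩
  · exact Or.inl ⟨i, hi, rfl, Or.inl (by rw [h4])⟩
  · exact Or.inr ⟨i, hi, hst, h4, rfl⟩

theorem share_of_mem {e f : ℕ × ℕ} {i : ℕ} (he : i = e.1 ∨ i = e.2) (hf : i = f.1 ∨ i = f.2) :
    share e f = true := by
  rw [share_iff]
  omega

theorem Config.share_of_touch (C : Config G n E fl st u v) {e f : ℕ × ℕ} (he : IsKey n E st e)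
    (hf : IsKey n E st f) (h : Touch (edgeOf u v e) (edgeOf u v f)) : share e f = true := by
  obtain ⟨x, h1, h2⟩ := h
  rcases he.mem_edgeOf C h1 with ⟨i, hi, rfl, h3⟩ | ⟨i, hi, hst, rfl, rfl⟩ <;>
    rcases hf.mem_edgeOf C h2 with ⟨j, hj, hx, k3⟩ | ⟨j, hj, hst', rfl, hx⟩
  · cases C.inj i hi j hj hx
    exact share_of_mem h3 k3
  · exact absurd hx.symm (C.outside j hj hst' i hi)
  · exact absurd hx (C.outside i hi hst j hj)
  · cases C.vinj i hi j hj hst hst' hx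
    exact share_of_mem (Or.inl rfl) (Or.inl rfl)

theorem Config.conf_of_near (C : Config G n E fl st u v) {e f : ℕ × ℕ} (he : IsKey n E st e)
    (hf : IsKey n E st f) (h : Near G (edgeOf u v e) (edgeOf u v f)) :
    conf E (lax fl st) e f = true := by
  obtain ⟨x, h1, y, h2, h | h⟩ := h
  · exact conf_of_share (C.share_of_touch he hf ⟨x, h1, h ▸ h2⟩)
  have hout : ∀ i < n, ∀ j < n, st j ≠ 2 → G.Adj (u i) (v j) → i = j := by
    intro i hi j hj hst hij
    rcases C.nbr i hi _ hij with ⟨k, hk, h'⟩ | ⟨h', h''⟩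
    · exact absurd h' (C.outside j hj hst k hk)
    · exact (C.vinj j hj i hi hst h' h'').symm
  rcases he.mem_edgeOf C h1 with ⟨i, hi, rfl, h3⟩ | ⟨i, hi, hst, rfl, rfl⟩ <;>
    rcases hf.mem_edgeOf C h2 with ⟨j, hj, rfl, k3⟩ | ⟨j, hj, hst', rfl, rfl⟩
  · have := (C.adj i hi j hj).1 h
    apply conf_of_joined
    rcases h3 with rfl | rfl <;> rcases k3 with rfl | rfl <;> simp [this]
  · cases hout i hi j hj hst' h
    exact conf_of_share (share_of_mem h3 (Or.inl rfl))
  · cases hout j hj i hi hst h.symm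
    exact conf_of_share (share_of_mem (Or.inl rfl) k3)
  · have : (lax fl st i && lax fl st j) = false := by
      by_contra hl
      simp only [lax, Bool.not_eq_false, Bool.and_eq_true, beq_iff_eq] at hl
      exact C.indep hl.1.1 i hi j hj hl.1.2 hl.2.2 h
    simp [conf, this]

theorem Config.not_touch_outer (C : Config G n E fl st u v) {e : ℕ × ℕ} (he : IsKey n E st e)
    {f : Sym2 V} (hf : f ∈ outer G n u) (h : Touch (edgeOf u v e) f) :
    ∃ i < n, st i ≠ 2 ∧ e = (i, i) ∧ v i ∈ f := by
  obtain ⟨x, h1, h2⟩ := h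
  rcases he.mem_edgeOf C h1 with ⟨i, hi, rfl, h3⟩ | ⟨i, hi, hst, rfl, rfl⟩
  · exact absurd h2 (hf.2 i hi)
  · exact ⟨i, hi, hst, rfl, h2⟩

theorem Config.near_outer (C : Config G n E fl st u v) {e : ℕ × ℕ} (he : IsKey n E st e)
    {f : Sym2 V} (hf : f ∈ outer G n u) (h : Near G (edgeOf u v e) f) :
    (∃ i < n, st i ≠ 2 ∧ (i = e.1 ∨ i = e.2) ∧ v i ∈ f) ∨
      ∃ i < n, st i ≠ 2 ∧ e = (i, i) ∧ ∃ y ∈ f, G.Adj (v i) y := by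
  obtain ⟨x, h1, y, h2, h⟩ := h
  rcases he.mem_edgeOf C h1 with ⟨i, hi, rfl, h3⟩ | ⟨i, hi, hst, rfl, rfl⟩
  · rcases h with rfl | h
    · exact absurd h2 (hf.2 i hi)
    · rcases C.nbr i hi y h with ⟨j, hj, rfl⟩ | ⟨hst, rfl⟩
      · exact absurd h2 (hf.2 j hj)
      · exact Or.inl ⟨i, hi, hst, h3, h2⟩
  · rcases h with rfl | h
    · exact Or.inl ⟨i, hi, hst, Or.inl rfl, h2⟩
    · exact Or.inr ⟨i, hi, hst, rfl, y, h2, h⟩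

end Configurations

/-! ### Soundness of the game -/

/-- The number of colors that have to work for a key. -/
def weight (st : ℕ → ℕ) (e : ℕ × ℕ) : ℕ × ℕ :=
  if e.1 = e.2 then if st e.1 = 0 then (5, 2) else (3, 4) else (1, 6)

/-- The restrictions on the color `k` of the key `f` caused by degrees and by the sets `S` of colors
of the outer edges at the vertices `v i`. -/
def Admissible {V : Type} (G : SimpleGraph V) (st : ℕ → ℕ) (u : ℕ → V) (S : ℕ → Finset (Fin 8))
    (f : ℕ × ℕ) (k : Fin 8) : Prop :=
  (k = 0 → (G.neighborSet (u f.1)).ncard = 3 ∧ (G.neighborSet (u f.2)).ncard = 3 ∧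
    (f.1 = f.2 → st f.1 = 0)) ∧
  (k ≠ 0 → (f.1 = f.2 → st f.1 ≠ 0) → k ∉ S f.1 ∧ k ∉ S f.2)

/-- The coloring `c` of the outer edges and of the keys in `D` matches the state `s` of the game
on the remaining keys `l`. -/
structure Matches {V : Type} (G : SimpleGraph V) (n : ℕ) (E : List (ℕ × ℕ)) (fl : Bool)
    (st : ℕ → ℕ) (u v : ℕ → V) (S : ℕ → Finset (Fin 8)) (D : Set (ℕ × ℕ)) (l : List (ℕ × ℕ)) (s : ℕ)
    (c : Sym2 V → Fin 8) : Prop where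
  done : ∀ e ∈ D, IsKey n E st e
  todo : ∀ e ∈ l, IsKey n E st e
  nodup : l.Nodup
  disjoint : ∀ e ∈ l, e ∉ D
  cover : ∀ e, IsKey n E st e → e ∈ D ∨ e ∈ l
  good : PartialGood G (outer G n u ∪ edgeOf u v '' D) c
  bound : ∀ i < n, st i ≠ 2 → ∀ f ∈ outer G n u, v i ∈ f → c f ≠ 0 → c f ∈ S i
  zeroFree : ∀ i < n, st i = 0 → (i, i) ∈ l → ∀ f ∈ outer G n u, v i ∈ f → c f ≠ 0
  bits : ∀ i, ∀ hi : i < l.length, ∀ k : Fin 8, s.testBit (8 * i + k) = true →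
    Admissible G st u S l[i] k ∧ ∀ e ∈ D, c (edgeOf u v e) = k →
      (k = 0 → share e l[i] = false) ∧ (k ≠ 0 → conf E (lax fl st) e l[i] = false)

section Soundness

variable {V : Type} {G : SimpleGraph V} {n : ℕ} {E : List (ℕ × ℕ)} {fl : Bool}
  {st : ℕ → ℕ} {u v : ℕ → V} {S : ℕ → Finset (Fin 8)} {D : Set (ℕ × ℕ)} {l : List (ℕ × ℕ)} {s : ℕ}
  {c : Sym2 V → Fin 8} {e : ℕ × ℕ}

open Classical in
theorem Matches.step (C : Config G n E fl st u v)
    (h : Matches G n E fl st u v S D (e :: l) s c) {k : Fin 8} (hk : s.testBit k = true)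
    {c' : Sym2 V → Fin 8} (hc' : PartialGood G (outer G n u ∪ edgeOf u v '' D) c')
    (hch : ∀ f, c' f ≠ c f → c' f = 0 ∧ f ∈ outer G n u ∧ ∀ i, (i, i) ∈ l → v i ∉ f)
    (hfar : ∀ f ∈ outer G n u, c' f = k →
      (k = 0 → ¬Touch (edgeOf u v e) f) ∧ (k ≠ 0 → ¬Near G (edgeOf u v e) f))
    {m : ℕ} (hm : ∀ i, ∀ hi : i < l.length, m.testBit (8 * i + k) = true →
      (k = 0 → share e l[i] = false) ∧ (k ≠ 0 → conf E (lax fl st) e l[i] = false)) :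
    Matches G n E fl st u v S (insert e D) l (Nat.land (Nat.shiftRight s 8) m)
      (Function.update c' (edgeOf u v e) k) := by
  have heK := h.todo e (by simp)
  have hO : ∀ f ∈ outer G n u, Function.update c' (edgeOf u v e) k f = c' f := fun f hf =>
    Function.update_of_ne (by rintro rfl; exact C.edgeOf_notMem_outer heK hf) _ _
  have hD : ∀ d ∈ D, Function.update c' (edgeOf u v e) k (edgeOf u v d) = c (edgeOf u v d) := by
    intro d hd
    rw [Function.update_of_ne]
    · by_contra hne
      exact C.edgeOf_notMem_outer (h.done d hd) (hch _ hne).2.1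
    · intro hde
      cases C.edgeOf_inj (h.done d hd) heK hde
      exact h.disjoint e (by simp) hd
  have hcD : ∀ d ∈ D, c' (edgeOf u v d) = c (edgeOf u v d) := by
    intro d hd
    by_contra hne
    exact C.edgeOf_notMem_outer (h.done d hd) (hch _ hne).2.1
  have h0 := h.bits 0 (by simp) k (by simpa using hk)
  rw [List.getElem_cons_zero] at h0
  refine ⟨?_, fun f hf => h.todo f (by simp [hf]), h.nodup.of_cons, ?_, ?_, ?_, ?_, ?_, ?_⟩
  · rintro d (rfl | hd)
    · exact heK
    · exact h.done d hd
  · rintro f hf (rfl | hfD)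
    · exact (List.nodup_cons.1 h.nodup).1 hf
    · exact h.disjoint f (by simp [hf]) hfD
  · intro f hf
    rcases h.cover f hf with hf | hf
    · exact Or.inl (Or.inr hf)
    · rcases List.mem_cons.1 hf with rfl | hf
      · exact Or.inl (Or.inl rfl)
      · exact Or.inr hf
  · rw [Set.image_insert_eq, Set.union_insert]
    refine hc'.insert_update ?_ ?_ ?_
    · rintro (hf | ⟨d, hd, hde⟩)
      · exact C.edgeOf_notMem_outer heK hf
      · cases C.edgeOf_inj (h.done d hd) heK hde
        exact h.disjoint e (by simp) hd
    · rintro rfl a ha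
      have hz := h0.1.1 rfl
      rcases heK.mem_edgeOf C ha with ⟨i, hi, rfl, rfl | rfl⟩ | ⟨i, hi, hst, rfl, rfl⟩
      · exact hz.1
      · exact hz.2.1
      · exact C.deg_eq i hi (hz.2.2 rfl)
    · rintro f (hf | ⟨d, hd, rfl⟩) hfk
      · exact hfar f hf hfk
      · have := h0.2 d hd ((hcD d hd).symm.trans hfk)
        refine ⟨fun hk0 ht => ?_, fun hk0 ht => ?_⟩
        · simpa [this.1 hk0] using C.share_of_touch (h.done d hd) heK ht.symm
        · simpa [this.2 hk0] using C.conf_of_near (h.done d hd) heK ht.symm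
  · intro i hi hst f hf hvf hne
    rw [hO f hf] at hne ⊢
    have hcf : c' f = c f := by
      by_contra hcf
      exact hne (hch f hcf).1
    rw [hcf] at hne ⊢
    exact h.bound i hi hst f hf hvf hne
  · intro i hi hst hil f hf hvf
    rw [hO f hf]
    by_cases hcf : c' f = c f
    · rw [hcf]
      exact h.zeroFree i hi hst (by simp [hil]) f hf hvf
    · exact absurd hvf ((hch f hcf).2.2 i hil)
  · intro i hi j hj
    obtain ⟨hs, hmj⟩ := testBit_shiftRight_land hj
    have hb := h.bits (i + 1) (by simpa using hi) j hs
    rw [List.getElem_cons_succ] at hb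
    refine ⟨hb.1, ?_⟩
    rintro d (rfl | hd) hdj
    · rw [Function.update_self] at hdj
      subst hdj
      exact hm i hi hmj
    · exact hb.2 d hd ((hD d hd).symm.trans hdj)

/-- A color that works and avoids a small set of colors. -/
theorem exists_mem_notMem_of_ncard_lt {K : Finset ℕ} {Y : Set (Fin 8)} (h : Y.ncard < K.card)
    (hK : ∀ k ∈ K, 0 < k ∧ k < 8) : ∃ k : Fin 8, (k : ℕ) ∈ K ∧ k ≠ 0 ∧ k ∉ Y := by
  have h1 : (Fin.val '' Y).ncard < (K : Set ℕ).ncard := by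
    rw [Set.ncard_coe_finset]
    exact (Set.ncard_image_le (Set.toFinite _)).trans_lt h
  obtain ⟨k, hk, hkY⟩ := Set.exists_mem_notMem_of_ncard_lt_ncard h1 (Set.toFinite _)
  obtain ⟨h2, h3⟩ := hK k hk
  refine ⟨⟨k, h3⟩, hk, ?_, fun h => hkY ⟨_, h, rfl⟩⟩
  intro h
  have := congrArg Fin.val h
  simp only [Fin.val_zero] at this
  omega

/-- At a leaving edge towards a vertex of degree 3, all but four colors are possible. -/
theorem Matches.exists_recolor_three [Finite V] (hG : Subcubic G)
    (C : Config G n E fl st u v) {i : ℕ}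
    (h : Matches G n E fl st u v S D ((i, i) :: l) s c) (hi : i < n) (hst : st i = 0) :
    ∃ Y : Set (Fin 8), Y.ncard ≤ 4 ∧ ∀ p, p ≠ 0 → p ∉ Y → ∃ c' : Sym2 V → Fin 8,
      PartialGood G (outer G n u ∪ edgeOf u v '' D) c' ∧
      (∀ f, c' f ≠ c f → c' f = 0 ∧ f ∈ outer G n u ∧ ∀ i, (i, i) ∈ l → v i ∉ f) ∧
      ∀ f ∈ outer G n u, c' f = p → ¬Near G (edgeOf u v (i, i)) f := by
  have hst2 : st i ≠ 2 := by omega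
  have hd := C.deg_eq i hi hst
  have hu : u i ∈ G.neighborSet (v i) := (C.leave i hi hst2).symm
  have h2 : (G.neighborSet (v i) \ {u i}).ncard = 2 := by
    rw [Set.ncard_sdiff_singleton_of_mem hu, hd]
  obtain ⟨w, w', hne, hww⟩ := Set.ncard_eq_two.1 h2
  have hmem : ∀ x, G.Adj (v i) x ↔ x = u i ∨ x = w ∨ x = w' := by
    intro x
    have := Set.ext_iff.1 hww x
    simp only [Set.mem_sdiff, mem_neighborSet, Set.mem_singleton_iff, Set.mem_insert_iff] at this
    by_cases hx : x = u i
    · subst hx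
      simpa using hu
    · simpa [hx] using this
  have huw : ∀ x, x = w ∨ x = w' → x ≠ u i := by
    rintro x hx rfl
    have : u i ∈ G.neighborSet (v i) \ {u i} := by rw [hww]; simpa using hx
    exact this.2 rfl
  have hOw : ∀ x, x = w ∨ x = w' → s(v i, x) ∈ outer G n u := by
    intro x hx
    have hvx : G.Adj (v i) x := (hmem x).2 (Or.inr hx)
    refine ⟨hvx, fun j hj hjm => ?_⟩
    rcases Sym2.mem_iff.1 hjm with hj' | rfl
    · exact C.outside i hi hst2 j hj hj'.symm
    · rcases C.nbr j hj _ hvx.symm with ⟨k, hk, hk'⟩ | ⟨hj2, hj'⟩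
      · exact C.outside i hi hst2 k hk hk'
      · cases C.vinj i hi j hj hst2 hj2 hj'
        exact huw _ hx rfl
  have hF : outer G n u ∪ edgeOf u v '' D ⊆ G.edgeSet := by
    rintro f (hf | ⟨d, hd, rfl⟩)
    · exact hf.1
    · exact C.edgeOf_mem (h.done d hd)
  have hB : ∀ x ∈ {x | ∃ j < n, st j ≠ 2 ∧ j ≠ i ∧ x = v j},
      ∃ y, G.Adj x y ∧ y ≠ v i ∧ s(x, y) ∉ outer G n u := by
    rintro x ⟨j, hj, hj2, -, rfl⟩
    exact ⟨u j, (C.leave j hj hj2).symm, fun h => C.outside i hi hst2 j hj h.symm,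
      fun h => h.2 j hj (by simp)⟩
  have hFv : ∀ f ∈ outer G n u ∪ edgeOf u v '' D, v i ∈ f → f = s(v i, w) ∨ f = s(v i, w') := by
    rintro f (hf | ⟨d, hd, rfl⟩) hvf
    · obtain ⟨x, rfl⟩ := hvf
      rcases (hmem x).1 hf.1 with rfl | rfl | rfl
      · exact absurd (by simp) (hf.2 i hi)
      · exact Or.inl rfl
      · exact Or.inr rfl
    · rcases (h.done d hd).mem_edgeOf C hvf with ⟨j, hj, hvj, -⟩ | ⟨j, hj, hj2, rfl, hvj⟩
      · exact absurd hvj (C.outside i hi hst2 j hj)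
      · cases C.vinj i hi j hj hst2 hj2 hvj
        exact absurd hd (h.disjoint _ (by simp))
  obtain ⟨Y, hY, hp⟩ := exists_recolor hG Set.subset_union_left hF h.good hd hne
    (hOw w (Or.inl rfl))
    (hOw w' (Or.inr rfl)) hFv (h.zeroFree i hi hst (by simp) _ (hOw w (Or.inl rfl)) (by simp))
    (h.zeroFree i hi hst (by simp) _ (hOw w' (Or.inr rfl)) (by simp))
    {x | ∃ j < n, st j ≠ 2 ∧ j ≠ i ∧ x = v j}
    (by rintro ⟨j, hj, hj2, hji, hv⟩; exact hji (C.vinj i hi j hj hst2 hj2 hv).symm) hB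
  refine ⟨Y, hY, fun p hp0 hpY => ?_⟩
  obtain ⟨c', h1, h2, h3⟩ := hp p hp0 hpY
  refine ⟨c', h1, fun f hf => ?_, fun f hf hfp hnear => h3 f hf ?_ hfp⟩
  · obtain ⟨k1, k2, k3, k4⟩ := h2 f hf
    refine ⟨k1, k2, fun j hj => ?_⟩
    have hjl : (j, j) ∈ (i, i) :: l := by simp [hj]
    rcases (h.todo _ hjl).cases C with ⟨-, -, -, hjj, -⟩ | ⟨j', hj', hst', hjj, -⟩
    · exact absurd rfl hjj
    · cases hjj
      refine k4 _ ⟨j, hj', hst', ?_, rfl⟩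
      rintro rfl
      exact (List.nodup_cons.1 h.nodup).1 hj
  · rcases C.near_outer (h.todo _ (by simp)) hf hnear with
      ⟨j, hj, hj2, hji, hvf⟩ | ⟨j, hj, hj2, hji, y, hyf, hy⟩
    · obtain rfl : j = i := by simpa using hji
      exact Or.inl hvf
    · cases hji
      rcases (hmem y).1 hy with rfl | rfl | rfl
      · exact absurd hyf (hf.2 i hi)
      · exact Or.inr (Or.inl hyf)
      · exact Or.inr (Or.inr hyf)

/-- At a leaving edge towards a vertex of degree at most 2, all but two colors are possible. -/
theorem Matches.exists_far_two [Finite V] (hG : Subcubic G) (C : Config G n E fl st u v) {i : ℕ}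
    (h : Matches G n E fl st u v S D ((i, i) :: l) s c) (hi : i < n) (hst : st i = 1) :
    ∃ Y : Set (Fin 8), Y.ncard ≤ 2 ∧ ∀ p : Fin 8, p ≠ 0 → p ∉ Y → p ∉ S i →
      ∀ f ∈ outer G n u, c f = p → ¬Near G (edgeOf u v (i, i)) f := by
  have hst2 : st i ≠ 2 := by omega
  have hd := C.deg_le i hi hst
  have hu : u i ∈ G.neighborSet (v i) := (C.leave i hi hst2).symm
  have key : ∀ p : Fin 8, p ≠ 0 → p ∉ S i → ∀ f ∈ outer G n u, c f = p →
      v i ∉ f := by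
    intro p hp0 hpS f hf hfp hvf
    have := h.bound i hi hst2 f hf hvf (hfp ▸ hp0)
    exact hpS (hfp ▸ this)
  by_cases hw : ∃ w, G.Adj (v i) w ∧ w ≠ u i
  · obtain ⟨w, hw, hwu⟩ := hw
    refine ⟨_, ncard_sideColors_le_two (O := outer G n u) (c := c) hG hw, ?_⟩
    intro p hp0 hpY hpS f hf hfp hnear
    have hvf := key p hp0 hpS f hf hfp
    rcases C.near_outer (h.todo _ (by simp)) hf hnear with
      ⟨j, hj, hj2, hji, hvf'⟩ | ⟨j, hj, hj2, hji, y, hyf, hy⟩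
    · obtain rfl : j = i := by simpa using hji
      exact hvf hvf'
    · cases hji
      have hyw : y = w := by
        by_contra hyw
        have hyu : y ≠ u i := by
          rintro rfl
          exact hf.2 i hi hyf
        have hsub : ({u i, w, y} : Set V) ⊆ G.neighborSet (v i) := by
          rintro x (rfl | rfl | rfl)
          · exact hu
          · exact hw
          · exact hy
        have := Set.ncard_le_ncard hsub (Set.toFinite _)
        rw [Set.ncard_eq_three.2 ⟨u i, w, y, hwu.symm, hyu.symm, Ne.symm hyw, rfl⟩] at this
        omega
      subst hyw
      exact hpY (hfp ▸ mem_sideColors outer_subset hf hyf hvf (hfp ▸ hp0))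
  · push Not at hw
    refine ⟨∅, by simp, fun p hp0 hpY hpS f hf hfp hnear => ?_⟩
    have hvf := key p hp0 hpS f hf hfp
    rcases C.near_outer (h.todo _ (by simp)) hf hnear with
      ⟨j, hj, hj2, hji, hvf'⟩ | ⟨j, hj, hj2, hji, y, hyf, hy⟩
    · obtain rfl : j = i := by simpa using hji
      exact hvf hvf'
    · cases hji
      rw [hw y hy] at hyf
      exact hf.2 i hi hyf

/-- Winning the game yields a good coloring. -/
theorem Matches.exists_goodColoring [Finite V] (hG : Subcubic G) (C : Config G n E fl st u v)
    (h : Matches G n E fl st u v S D l s c)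
    (hgame : game (rounds E (lax fl st) (weight st) l) s = true) :
    ∃ c : Sym2 V → Fin 8, GoodColoring G c := by
  classical
  induction l generalizing D s c with
  | nil =>
    refine ⟨c, PartialGood.goodColoring ?_⟩
    convert h.good using 1
    refine Set.Subset.antisymm (fun f hf => ?_) ?_
    · rcases C.mem_outer_or hf with hf | ⟨e, he, rfl⟩
      · exact Or.inl hf
      · rcases h.cover e he with he | he
        · exact Or.inr ⟨e, he, rfl⟩
        · simp at he
    · rintro f (hf | ⟨d, hd, rfl⟩)
      · exact hf.1
      · exact C.edgeOf_mem (h.done d hd)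
  | cons e l ih =>
    have heK := h.todo e (by simp)
    rcases game_cons hgame with ⟨hs, hg⟩ | ⟨K, hK, hg⟩
    · refine ih (h.step C (k := 0) hs h.good (fun f hf => absurd rfl hf) ?_ ?_) hg
      · refine fun f hf hf0 => ⟨fun _ ht => ?_, fun h0 => absurd rfl h0⟩
        obtain ⟨i, hi, hst, rfl, hvf⟩ := C.not_touch_outer heK hf ht
        have h0 := h.bits 0 (by simp) 0 (by simpa using hs)
        exact h.zeroFree i hi ((h0.1.1 rfl).2.2 rfl) (by simp) f hf hvf hf0
      · exact fun i hi hm => ⟨fun _ => not_of_testBit_clearMask hi (by omega) hm,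
          fun h0 => absurd rfl h0⟩
    · have hmask : ∀ k : Fin 8, k ≠ 0 → ∀ i, ∀ hi : i < l.length,
          (clearMask (conf E (lax fl st) e) l k).testBit (8 * i + k) = true →
          (k = 0 → share e l[i] = false) ∧ (k ≠ 0 → conf E (lax fl st) e l[i] = false) :=
        fun k hk i hi hm => ⟨fun h0 => absurd h0 hk,
          fun _ => not_of_testBit_clearMask hi k.2 hm⟩
      have hK8 : ∀ k ∈ K, 0 < k ∧ k < 8 := fun k hk => ⟨(hg k hk).1, (hg k hk).2.1⟩
      rcases heK.cases C with ⟨heE, h1, h2, hne, he⟩ | ⟨i, hi, hst, rfl, he⟩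
      · obtain ⟨k, hkK, hk0, -⟩ := exists_mem_notMem_of_ncard_lt (Y := ∅) (K := K) (by
          rw [weight, if_neg hne] at hK
          rw [Set.ncard_empty]
          exact hK) hK8
        obtain ⟨-, -, hs, hg⟩ := hg k hkK
        refine ih (h.step C hs h.good (fun f hf => absurd rfl hf) ?_ (hmask k hk0)) hg
        refine fun f hf hfk => ⟨fun h0 => absurd h0 hk0, fun _ hnear => ?_⟩
        have ha := (h.bits 0 (by simp) k (by simpa using hs)).1.2 (by simpa using hk0)
          (fun h => absurd h hne)
        rw [List.getElem_cons_zero] at ha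
        rcases C.near_outer heK hf hnear with ⟨j, hj, hj2, hji, hvf⟩ | ⟨j, hj, hj2, rfl, -⟩
        · have := h.bound j hj hj2 f hf hvf (hfk ▸ hk0)
          rw [hfk] at this
          rcases hji with rfl | rfl
          · simp [this] at ha
          · simp [this] at ha
        · exact hne rfl
      · by_cases hst0 : st i = 0
        · obtain ⟨Y, hY, hp⟩ := h.exists_recolor_three hG C hi hst0
          obtain ⟨k, hkK, hk0, hkY⟩ := exists_mem_notMem_of_ncard_lt (Y := Y) (K := K) (by
            rw [weight, if_pos rfl, if_pos hst0] at hK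
            exact (Nat.lt_succ_of_le hY).trans_le hK) hK8
          obtain ⟨-, -, hs, hg⟩ := hg k hkK
          obtain ⟨c', h1, h2, h3⟩ := hp k hk0 hkY
          exact ih (h.step C hs h1 h2 (fun f hf hfk => ⟨fun h0 => absurd h0 hk0,
            fun _ => h3 f hf hfk⟩) (hmask k hk0)) hg
        · have hst1 : st i = 1 := by
            have := C.st_le i hi
            omega
          obtain ⟨Y, hY, hp⟩ := h.exists_far_two hG C hi hst1
          obtain ⟨k, hkK, hk0, hkY⟩ := exists_mem_notMem_of_ncard_lt (Y := Y) (K := K) (by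
            rw [weight, if_pos rfl, if_neg hst0] at hK
            exact (Nat.lt_succ_of_le hY).trans_le hK) hK8
          obtain ⟨-, -, hs, hg⟩ := hg k hkK
          have ha := (h.bits 0 (by simp) k (by simpa using hs)).1.2 (by simpa using hk0)
            (fun _ => hst0)
          exact ih (h.step C hs h.good (fun f hf => absurd rfl hf) (fun f hf hfk =>
            ⟨fun h0 => absurd h0 hk0, fun _ => hp k hk0 hkY ha.1 f hf hfk⟩) (hmask k hk0)) hg

end Soundness

/-! ### Enumerating the colors at the outer vertices up to permutation -/

/-- The key `f` is incident to the index `i` and its color has to avoid the colors at `v i`. -/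
def avoids (st : ℕ → ℕ) (i : ℕ) (f : ℕ × ℕ) : Bool :=
  (f.1 == i || f.2 == i) && !(f.1 == f.2 && st f.1 == 0)

/-- `p` holds for `1, …, n`. -/
def allTo (n : ℕ) (p : ℕ → Bool) : Bool := Nat.rec true (fun k ih => p (k + 1) && ih) n

/-- The game is won for all choices of one or two colors at each of the listed indices, where
the colors up to `m` are already used and the others are interchangeable. -/
def enum (st : ℕ → ℕ) (rs : List Round) (l : List (ℕ × ℕ)) : List (ℕ × ℕ) → ℕ → ℕ → Bool
  | [], _, s => game rs s
  | p :: r, m, s =>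
    allTo (min 7 (m + 1)) fun a => force (max m a) fun m' =>
      force (Nat.land s (clearMask (avoids st p.1) l a)) fun s' =>
      bif p.2 == 1 then enum st rs l r m' s'
      else allTo (min 7 (m' + 1)) fun b =>
        bif Nat.ble b a then true else force (max m b) fun m'' =>
          force (Nat.land s' (clearMask (avoids st p.1) l b)) fun s'' => enum st rs l r m'' s''

/-- Start the game on the keys `l`, given the initially available colors. -/
def start (E : List (ℕ × ℕ)) (fl : Bool) (st : ℕ → ℕ) (ok : ℕ × ℕ → ℕ → Bool)
    (l vs : List (ℕ × ℕ)) (m : ℕ) : Bool :=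
  withRounds E (lax fl st) (weight st) l fun rs =>
    force (pack (l.map fun f => Nat.ofBits (n := 8) fun k => ok f k)) fun s => enum st rs l vs m s

section Enumeration

theorem of_allTo {n : ℕ} {p : ℕ → Bool} (h : allTo n p = true) {k : ℕ} (h0 : 0 < k) (hk : k ≤ n) :
    p k = true := by
  induction n with
  | zero => omega
  | succ n ih =>
    obtain ⟨h1, h2⟩ := Bool.and_eq_true_iff.1 (show (p (n + 1) && allTo n p) = true from h)
    rcases Nat.lt_succ_iff_lt_or_eq.1 (Nat.lt_succ_of_le hk) with hk | rfl
    · exact ih h2 (by omega)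
    · exact h1

/-- A color can be moved to the first unused one, if it is not already used. -/
theorem exists_perm_le (m : ℕ) (x : Fin 8) (hx : x ≠ 0) : ∃ σ : Equiv.Perm (Fin 8),
    (∀ y : Fin 8, (y : ℕ) ≤ m → σ y = y) ∧ 0 < (σ x : ℕ) ∧ (σ x : ℕ) ≤ min 7 (m + 1) ∧
      (m < x → (σ x : ℕ) = m + 1) := by
  have hx0 : 0 < (x : ℕ) := Nat.pos_of_ne_zero fun h => hx (Fin.ext h)
  by_cases hxm : (x : ℕ) ≤ m
  · exact ⟨1, fun _ _ => rfl, hx0, by simp; omega, fun h => absurd hxm (by omega)⟩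
  · refine ⟨Equiv.swap x ⟨m + 1, by omega⟩, fun y hy => ?_, ?_, ?_, ?_⟩
    · refine Equiv.swap_apply_of_ne_of_ne ?_ ?_ <;> rintro rfl
      · exact hxm hy
      · simp at hy
    all_goals simp
    omega

theorem testBit_land_clearMask {p : ℕ × ℕ → Bool} {l : List (ℕ × ℕ)} {s a i : ℕ} {k : Fin 8}
    (hi : i < l.length)
    (h : (Nat.land s (clearMask p l a)).testBit (8 * i + k) = true) :
    s.testBit (8 * i + k) = true ∧ (p l[i] = true → (k : ℕ) ≠ a) := by
  change (s &&& clearMask p l a).testBit (8 * i + k) = true at h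
  rw [Nat.testBit_land, Bool.and_eq_true] at h
  refine ⟨h.1, fun hp hk => ?_⟩
  subst hk
  simp [not_of_testBit_clearMask hi k.2 h.2] at hp

theorem exists_perm_of_enum {st : ℕ → ℕ} {rs : List Round} {l vs : List (ℕ × ℕ)} {m s : ℕ}
    (h : enum st rs l vs m s = true) (A : ℕ → Finset (Fin 8)) (hA0 : ∀ p ∈ vs, 0 ∉ A p.1)
    (hA : ∀ p ∈ vs, (A p.1).card = p.2 ∧ (p.2 = 1 ∨ p.2 = 2)) :
    ∃ τ : Equiv.Perm (Fin 8), (∀ x : Fin 8, (x : ℕ) ≤ m → τ x = x) ∧ ∃ s', game rs s' = true ∧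
      ∀ i, ∀ hi : i < l.length, ∀ k : Fin 8, s'.testBit (8 * i + k) = true →
        s.testBit (8 * i + k) = true ∧
        ∀ p ∈ vs, avoids st p.1 l[i] = true → ∀ x ∈ A p.1, k ≠ τ x := by
  classical
  induction vs generalizing m s A with
  | nil => exact ⟨1, fun _ _ => rfl, s, h, fun i hi k hk => ⟨hk, by simp⟩⟩
  | cons p r ih =>
    simp only [enum, force_eq] at h
    obtain ⟨hcard, hp⟩ := hA p (by simp)
    have h0 := hA0 p (by simp)
    have extend : ∀ (σ : Equiv.Perm (Fin 8)) (m' s' : ℕ), m ≤ m' →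
        (∀ x : Fin 8, (x : ℕ) ≤ m → σ x = x) → (∀ x ∈ A p.1, (σ x : ℕ) ≤ m') →
        enum st rs l r m' s' = true →
        (∀ i, ∀ hi : i < l.length, ∀ k : Fin 8, s'.testBit (8 * i + k) = true →
          s.testBit (8 * i + k) = true ∧
          (avoids st p.1 l[i] = true → ∀ x ∈ A p.1, k ≠ σ x)) →
        ∃ τ : Equiv.Perm (Fin 8), (∀ x : Fin 8, (x : ℕ) ≤ m → τ x = x) ∧ ∃ s',
          game rs s' = true ∧
          ∀ i, ∀ hi : i < l.length, ∀ k : Fin 8, s'.testBit (8 * i + k) = true →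
            s.testBit (8 * i + k) = true ∧
            ∀ q ∈ p :: r, avoids st q.1 l[i] = true → ∀ x ∈ A q.1, k ≠ τ x := by
      intro σ m' s' hm hσ hAm he hs
      have hσ0 : σ 0 = 0 := hσ 0 (by simp)
      obtain ⟨τ, hτ, s'', hg, hs''⟩ := ih he (fun i => (A i).map σ.toEmbedding)
        (fun q hq hmem => by
          obtain ⟨x, hx, hx0⟩ := Finset.mem_map.1 hmem
          obtain rfl : x = 0 := σ.injective (hx0.trans hσ0.symm)
          exact hA0 q (by simp [hq]) hx)
        (fun q hq => by simpa using hA q (by simp [hq]))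
      refine ⟨σ.trans τ, fun x hx => ?_, s'', hg, fun i hi k hk => ?_⟩
      · rw [Equiv.trans_apply, hσ x hx, hτ x (hx.trans hm)]
      · obtain ⟨h1, h2⟩ := hs'' i hi k hk
        obtain ⟨h3, h4⟩ := hs i hi k h1
        refine ⟨h3, fun q hq hav x hx => ?_⟩
        rcases List.mem_cons.1 hq with rfl | hq
        · rw [Equiv.trans_apply, hτ _ (hAm x hx)]
          exact h4 hav x hx
        · exact h2 q hq hav (σ x) (Finset.mem_map_of_mem σ.toEmbedding hx)
    rcases hp with hp | hp
    · obtain ⟨x, hx⟩ := Finset.card_eq_one.1 (hcard.trans hp)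
      rw [hx] at h0
      obtain ⟨σ, hσ, hpos, hle, -⟩ := exists_perm_le m x fun h => h0 (by simp [h])
      have h1 := of_allTo h hpos hle
      rw [hp] at h1
      refine extend σ (max m (σ x)) _ (le_max_left ..) hσ (by simp [hx]) h1 fun i hi k hk => ?_
      obtain ⟨h2, h3⟩ := testBit_land_clearMask hi hk
      refine ⟨h2, fun hav y hy hky => h3 hav ?_⟩
      rw [hx, Finset.mem_singleton] at hy
      rw [hky, hy]
    · obtain ⟨x, y, hxy, hx⟩ := Finset.card_eq_two.1 (hcard.trans hp)
      rw [hx] at h0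
      have hx0 : x ≠ 0 := fun h => h0 (by simp [h])
      have hy0 : y ≠ 0 := fun h => h0 (by simp [h])
      obtain ⟨σ, hσ, hpos, hle, -⟩ := exists_perm_le m x hx0
      have hσ0 : σ 0 = 0 := hσ 0 (by simp)
      obtain ⟨ρ, hρ, hpos', hle', -⟩ := exists_perm_le (max m (σ x)) (σ y)
        fun h => hy0 (σ.injective (h.trans hσ0.symm))
      have hρx : ρ (σ x) = σ x := hρ _ (le_max_right ..)
      have hne : (ρ (σ y) : ℕ) ≠ σ x := by
        intro h
        exact hxy (σ.injective (ρ.injective (hρx.trans (Fin.ext h).symm)))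
      have hfix : ∀ z : Fin 8, (z : ℕ) ≤ m → σ.trans ρ z = z := fun z hz => by
        rw [Equiv.trans_apply, hσ z hz, hρ z (hz.trans (le_max_left ..))]
      obtain ⟨a, b, ha, hab, ham, hbm, hcase⟩ : ∃ a b : ℕ, 0 < a ∧ a < b ∧ a ≤ min 7 (m + 1) ∧
          b ≤ min 7 (max m a + 1) ∧ (a = σ x ∧ b = ρ (σ y) ∨ a = ρ (σ y) ∧ b = σ x) := by
        rcases Nat.lt_or_gt_of_ne hne with hlt | hlt
        · exact ⟨_, _, hpos', hlt, by omega, by omega, Or.inr ⟨rfl, rfl⟩⟩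
        · exact ⟨_, _, hpos, hlt, hle, by omega, Or.inl ⟨rfl, rfl⟩⟩
      have h1 := of_allTo h ha ham
      rw [hp, show ((2 : ℕ) == 1) = false from rfl, cond_false] at h1
      have h2 := of_allTo h1 (ha.trans hab) hbm
      rw [show Nat.ble b a = false by
        rw [← Bool.not_eq_true, Nat.ble_eq]; omega] at h2
      refine extend (σ.trans ρ) (max m b) _ (le_max_left ..) hfix ?_ h2 fun i hi k hk => ?_
      · intro z hz
        simp only [hx, Finset.mem_insert, Finset.mem_singleton] at hz
        rcases hz with rfl | rfl
        · rw [Equiv.trans_apply, hρx]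
          omega
        · rw [Equiv.trans_apply]
          omega
      · obtain ⟨h3, h4⟩ := testBit_land_clearMask hi hk
        obtain ⟨h5, h6⟩ := testBit_land_clearMask hi h3
        refine ⟨h5, fun hav z hz hkz => ?_⟩
        have h4 := h4 hav
        have h6 := h6 hav
        simp only [hx, Finset.mem_insert, Finset.mem_singleton] at hz
        rw [hkz] at h4 h6
        rcases hz with rfl | rfl
        · rw [Equiv.trans_apply, hρx] at h4 h6
          omega
        · rw [Equiv.trans_apply] at h4 h6
          omega

/-- New colors can be renamed to the first unused ones. -/
theorem exists_perm_map_eq_range' (m : ℕ) (xs : List (Fin 8)) (hnd : xs.Nodup)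
    (hm : ∀ x ∈ xs, m < (x : ℕ)) : ∃ σ : Equiv.Perm (Fin 8),
    (∀ y : Fin 8, (y : ℕ) ≤ m → σ y = y) ∧
      xs.map (fun x => (σ x : ℕ)) = List.range' (m + 1) xs.length := by
  induction hl : xs.length generalizing m xs with
  | zero => exact ⟨1, fun _ _ => rfl, by simp [List.length_eq_zero_iff.1 hl]⟩
  | succ len ih =>
    obtain ⟨x, xs, rfl⟩ := List.exists_cons_of_length_eq_add_one hl
    have hx := hm x (by simp)
    obtain ⟨σ, hσ, -, -, hx1⟩ := exists_perm_le m x (by rintro rfl; simp at hx)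
    have hx1 := hx1 hx
    obtain ⟨hxn, hnd⟩ := List.nodup_cons.1 hnd
    obtain ⟨τ, hτ, hmap⟩ := ih (m + 1) (xs.map σ) (hnd.map σ.injective) (fun z hz => by
      obtain ⟨y, hy, rfl⟩ := List.mem_map.1 hz
      have h1 : m < (σ y : ℕ) := by
        by_contra hle
        have h2 : σ y = y := σ.injective (hσ _ (by omega))
        have h3 := hm y (by simp [hy])
        rw [h2] at hle
        exact hle h3
      have h2 : (σ y : ℕ) ≠ m + 1 := fun h =>
        hxn (σ.injective (Fin.ext (h.trans hx1.symm)) ▸ hy)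
      omega) (by simpa using hl)
    refine ⟨σ.trans τ, fun y hy => ?_, ?_⟩
    · rw [Equiv.trans_apply, hσ y hy, hτ y (by omega)]
    · rw [List.map_map] at hmap
      rw [List.map_cons, List.range'_succ, Equiv.trans_apply,
        hτ (σ x) hx1.le, hx1]
      exact congrArg _ hmap

end Enumeration

/-! ### Checking a configuration -/

/-- The degree of `i` in the configuration. -/
def edeg (n : ℕ) (E : List (ℕ × ℕ)) (i : ℕ) : ℕ := ((List.range n).filter (joined E i)).length

/-- All neighbors of `u i` are determined, and there are three of them. -/
def full (n : ℕ) (E : List (ℕ × ℕ)) (st : ℕ → ℕ) (i : ℕ) : Bool :=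
  (bif st i == 2 then edeg n E i else edeg n E i + 1) == 3

/-- The keys of a configuration, in the order in which they are colored. -/
def keys (n : ℕ) (E : List (ℕ × ℕ)) (st : ℕ → ℕ) : List (ℕ × ℕ) :=
  (((List.range n).filter fun i => st i == 0).map fun i => (i, i)) ++
    (((List.range n).filter fun i => st i == 1).map fun i => (i, i)) ++ E

/-- The indices with a leaving edge, with the number of forbidden colors there. -/
def ends (n : ℕ) (st : ℕ → ℕ) : List (ℕ × ℕ) :=
  ((List.range n).filter fun i => !(st i == 2)).map fun i => (i, 2 - st i)

/-- The key `f` may initially receive the color `k`. -/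
def allowed (n : ℕ) (E : List (ℕ × ℕ)) (st : ℕ → ℕ) (f : ℕ × ℕ) (k : ℕ) : Bool :=
  !(k == 0) || full n E st f.1 && full n E st f.2 && (!(f.1 == f.2) || st f.1 == 0)

/-- Every coloring of the edges avoiding the configuration can be extended. -/
def check (n : ℕ) (E : List (ℕ × ℕ)) (fl : Bool) (st : ℕ → ℕ) : Bool :=
  start E fl st (allowed n E st) (keys n E st) (ends n st) 0

/-- The check for the graph in which the configuration is replaced by an edge from `v P` to
`v Q`. -/
def checkAdd (n : ℕ) (E : List (ℕ × ℕ)) (P Q : ℕ) (st : ℕ → ℕ) : Bool :=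
  bif st P == 2 || st Q == 2 then check n E false st else
    let p := 2 - st P
    let q := 2 - st Q
    let ok := fun f k => allowed n E st f k &&
      !(avoids st P f && Nat.ble 1 k && Nat.ble k p) &&
      !(avoids st Q f && Nat.ble (p + 1) k && Nat.ble k (p + q))
    let vs := (ends n st).filter fun e => !(e.1 == P) && !(e.1 == Q)
    (!(st P == 0 && st Q == 0) || start E false st ok (keys n E st) vs (p + q)) &&
      start E false st (fun f k => ok f k && !(k == p + q + 1 &&
        (conf E (lax false st) (P, P) f || conf E (lax false st) (Q, Q) f)))
        ((keys n E st).filter fun e => !(e == (P, P)) && !(e == (Q, Q))) vs (p + q + 1)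

/-- `p` holds for all lists of `i` statuses, followed by `L`, that are compatible with the
degrees. -/
def forallStatus (n : ℕ) (E : List (ℕ × ℕ)) (p : List ℕ → Bool) : ℕ → List ℕ → Bool
  | 0, L => p L
  | i + 1, L => forallStatus n E p i (2 :: L) && (Nat.ble 3 (edeg n E i) ||
      forallStatus n E p i (0 :: L) && forallStatus n E p i (1 :: L))

/-- The check for all statuses. -/
def checkAll (n : ℕ) (E : List (ℕ × ℕ)) (p : (ℕ → ℕ) → Bool) : Bool :=
  forallStatus n E (fun L => p fun i => L.getD i 2) n []

section Start

variable {V : Type} {G : SimpleGraph V} {n : ℕ} {E : List (ℕ × ℕ)} {fl : Bool}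
  {st : ℕ → ℕ} {u v : ℕ → V} {D : Set (ℕ × ℕ)} {l vs : List (ℕ × ℕ)} {m : ℕ}
  {c : Sym2 V → Fin 8} {ok : ℕ × ℕ → ℕ → Bool}

/-- If the enumeration succeeds, then a coloring of the edges avoiding the configuration and of the
keys in `D` leads to a good coloring. -/
theorem Config.exists_of_start [Finite V] (hG : Subcubic G) (C : Config G n E fl st u v)
    (h : start E fl st ok l vs m = true)
    (done : ∀ e ∈ D, IsKey n E st e) (todo : ∀ e ∈ l, IsKey n E st e) (nodup : l.Nodup)
    (disjoint : ∀ e ∈ l, e ∉ D) (cover : ∀ e, IsKey n E st e → e ∈ D ∨ e ∈ l)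
    (good : PartialGood G (outer G n u ∪ edgeOf u v '' D) c) (A : ℕ → Finset (Fin 8))
    (bound : ∀ i < n, st i ≠ 2 → ∀ f ∈ outer G n u, v i ∈ f → c f ≠ 0 → c f ∈ A i)
    (zeroFree : ∀ i < n, st i = 0 → (i, i) ∈ l → ∀ f ∈ outer G n u, v i ∈ f → c f ≠ 0)
    (hA0 : ∀ i, 0 ∉ A i) (hA : ∀ p ∈ vs, (A p.1).card = p.2 ∧ (p.2 = 1 ∨ p.2 = 2))
    (hAm : ∀ i, (∀ p ∈ vs, p.1 ≠ i) → ∀ x ∈ A i, (x : ℕ) ≤ m)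
    (hDm : ∀ e ∈ D, (c (edgeOf u v e) : ℕ) ≤ m)
    (hok : ∀ f ∈ l, ∀ k : Fin 8, ok f k = true →
      (k = 0 → (G.neighborSet (u f.1)).ncard = 3 ∧ (G.neighborSet (u f.2)).ncard = 3 ∧
        (f.1 = f.2 → st f.1 = 0)) ∧
      (∀ i, (∀ p ∈ vs, p.1 ≠ i) → avoids st i f = true → k ∉ A i) ∧
      ∀ e ∈ D, c (edgeOf u v e) = k →
        (k = 0 → share e f = false) ∧ (k ≠ 0 → conf E (lax fl st) e f = false)) :
    ∃ c : Sym2 V → Fin 8, GoodColoring G c := by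
  rw [start, withRounds_eq, force_eq] at h
  obtain ⟨τ, hτ, s, hs, hbits⟩ := exists_perm_of_enum h A (fun p _ => hA0 p.1) hA
  have hτ0 : τ 0 = 0 := hτ 0 (by simp)
  have hne : ∀ f, τ (c f) ≠ 0 → c f ≠ 0 := fun f hf h0 => hf (by rw [h0, hτ0])
  refine Matches.exists_goodColoring hG C (S := fun i => (A i).map τ.toEmbedding)
    (c := fun f => τ (c f)) ⟨done, todo, nodup, disjoint, cover, good.comp_perm τ hτ0, ?_, ?_,
      ?_⟩ hs
  · exact fun i hi hst f hf hvf hcf =>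
      Finset.mem_map_of_mem τ.toEmbedding (bound i hi hst f hf hvf (hne f hcf))
  · exact fun i hi hst hil f hf hvf h0 =>
      zeroFree i hi hst hil f hf hvf (τ.injective (h0.trans hτ0.symm))
  · intro i hi k hk
    obtain ⟨h1, h2⟩ := hbits i hi k hk
    rw [testBit_pack _ _ i (by simpa using hi) k k.2, List.getElem_map,
      Nat.testBit_ofBits_lt _ _ k.2] at h1
    · obtain ⟨h3, h4, h5⟩ := hok l[i] (List.getElem_mem hi) k h1
      have hav : ∀ j, avoids st j l[i] = true → k ∉ (A j).map τ.toEmbedding := by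
        intro j hj hmem
        obtain ⟨x, hx, hxk⟩ := Finset.mem_map.1 hmem
        by_cases hjv : ∃ p ∈ vs, p.1 = j
        · obtain ⟨p, hp, rfl⟩ := hjv
          exact h2 p hp hj x hx hxk.symm
        · push Not at hjv
          have hxk' : τ x = k := hxk
          rw [hτ x (hAm j hjv x hx)] at hxk'
          exact h4 j hjv hj (hxk' ▸ hx)
      refine ⟨⟨h3, fun hk0 hst => ⟨hav _ ?_, hav _ ?_⟩⟩, fun e he hek => ?_⟩
      · simpa [avoids, imp_iff_not_or] using hst
      · simpa [avoids, imp_iff_not_or] using hst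
      · rw [hτ _ (hDm e he)] at hek
        exact h5 e he hek
    · intro b hb
      obtain ⟨f, -, rfl⟩ := List.mem_map.1 hb
      exact Nat.ofBits_lt_two_pow _

end Start

/-! ### Reductions -/

section Reductions

variable {V : Type} {G H : SimpleGraph V} {n : ℕ} {E : List (ℕ × ℕ)} {fl : Bool}
  {st : ℕ → ℕ} {u v : ℕ → V} {c : Sym2 V → Fin 8}

theorem GoodColoring.partialGood (h : GoodColoring G c) : PartialGood G G.edgeSet c := by
  obtain ⟨⟨h1, h2⟩, h3⟩ := h
  refine ⟨fun e he f hf hne hc => ⟨?_, ?_⟩, fun e he h0 a ha => ?_⟩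
  · rintro h0 ⟨a, ⟨b, rfl⟩, ⟨x, rfl⟩⟩
    exact (h1 a b a x he hf hne h0 (hc ▸ h0)).1 rfl
  · rintro h0 ⟨a, ⟨b, rfl⟩, x, ⟨y, rfl⟩, rfl | hax⟩
    · exact (h2 a b a y he hf hne hc h0).1.1 rfl
    · exact (h2 a b x y he hf hne hc h0).2.1 hax
  · obtain ⟨b, rfl⟩ := ha
    exact (h3 a b he h0).1

/-- A smaller graph containing the edges that avoid the configuration has a good coloring. -/
theorem MinCounter.exists_partialGood [Finite V] (hG : MinCounter V G)
    (hO : outer G n u ⊆ H.edgeSet)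
    (hdeg : ∀ x, (H.neighborSet x).ncard ≤ (G.neighborSet x).ncard)
    (hcard : H.edgeSet.ncard < G.edgeSet.ncard) :
    ∃ c, PartialGood H H.edgeSet c ∧ PartialGood G (outer G n u) c := by
  obtain ⟨c, hc⟩ := hG.2.2 V H (fun x => (hdeg x).trans (hG.1 x)) (by omega)
  have hc := hc.partialGood
  refine ⟨c, hc, fun e he f hf hne hce => ⟨(hc.1 e (hO he) f (hO hf) hne hce).1, fun h0 => ?_⟩,
    fun e he h0 a ha => ?_⟩
  · rintro ⟨a, ha, b, hb, hab⟩
    refine (hc.1 e (hO he) f (hO hf) hne hce).2 h0 ⟨a, ha, b, hb, hab.imp_right fun hab => ?_⟩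
    refine hO (show s(a, b) ∈ outer G n u from ⟨hab, fun i hi hmem => ?_⟩)
    rcases Sym2.mem_iff.1 hmem with rfl | rfl
    · exact he.2 i hi ha
    · exact hf.2 i hi hb
  · have h1 := hc.2 e (hO he) h0 a ha
    have h2 := hdeg a
    have h3 := hG.1 a
    omega

theorem ncard_neighborSet_lt_of_forall [Finite V] {x y : V} (hxy : G.Adj x y)
    (h : ∀ z, H.Adj x z → G.Adj x z ∧ z ≠ y) :
    (H.neighborSet x).ncard + 1 ≤ (G.neighborSet x).ncard := by
  have h1 : H.neighborSet x ⊆ G.neighborSet x \ {y} := h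
  have h2 := Set.ncard_le_ncard h1 (Set.toFinite _)
  have h3 := Set.ncard_sdiff_singleton_add_one (show y ∈ G.neighborSet x from hxy) (Set.toFinite _)
  omega

theorem adj_and_ne_of_mem_outer {i : ℕ} (hi : i < n) {x y : V}
    (h : s(x, y) ∈ outer G n u) : G.Adj x y ∧ x ≠ u i ∧ y ≠ u i :=
  ⟨h.1, fun hx => h.2 i hi (by simp [hx]), fun hy => h.2 i hi (by simp [hy])⟩

theorem Config.exists_partialGood [Finite V] (hG : MinCounter V G) (C : Config G n E fl st u v)
    (hE : E ≠ []) : ∃ c, PartialGood G (outer G n u) c ∧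
      ∀ i < n, st i = 0 → ∀ f ∈ outer G n u, v i ∈ f → c f ≠ 0 := by
  obtain ⟨e, he⟩ := List.exists_mem_of_ne_nil E hE
  have he : IsKey n E st e := Or.inl he
  have hes : (fromEdgeSet (outer G n u)).edgeSet = outer G n u := by
    rw [edgeSet_fromEdgeSet, sdiff_eq_left, Set.disjoint_left]
    exact fun f hf hd => G.not_isDiag_of_mem_edgeSet hf.1 hd
  have hadj : ∀ x y, (fromEdgeSet (outer G n u)).Adj x y ↔ s(x, y) ∈ outer G n u := fun x y => by
    rw [← mem_edgeSet, hes]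
  obtain ⟨c, hc, hc'⟩ := hG.exists_partialGood (H := fromEdgeSet (outer G n u)) hes.ge
    (fun x => Set.ncard_le_ncard (fun y hy => ((hadj x y).1 hy).1) (Set.toFinite _)) (by
      rw [hes]
      exact Set.ncard_lt_ncard ⟨outer_subset,
        fun h => C.edgeOf_notMem_outer he (h (C.edgeOf_mem he))⟩
        (Set.toFinite _))
  refine ⟨c, hc', fun i hi hst f hf hvf h0 => ?_⟩
  have h1 := hc.2 f (hes.ge hf) h0 _ hvf
  have h2 := ncard_neighborSet_lt_of_forall (H := fromEdgeSet (outer G n u))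
    (C.leave i hi (by omega)).symm fun z hz =>
      ⟨((hadj _ _).1 hz).1, (adj_and_ne_of_mem_outer hi ((hadj _ _).1 hz)).2.2⟩
  have := C.deg_eq i hi hst
  omega

/-- The coloring obtained by replacing the configuration by an edge from `v P` to `v Q`. -/
theorem Config.exists_partialGood_add [Finite V] (hG : MinCounter V G) (C : Config G n E fl st u v)
    {P Q : ℕ} (hP : P < n) (hQ : Q < n) (hPQ : P ≠ Q) (hstP : st P ≠ 2) (hstQ : st Q ≠ 2)
    (hv : ¬G.Adj (v P) (v Q)) : ∃ c, PartialGood G (outer G n u) c ∧ ∃ k,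
      (∀ i < n, st i = 0 → (i ≠ P ∧ i ≠ Q) ∨ k = 0 → ∀ f ∈ outer G n u, v i ∈ f → c f ≠ 0) ∧
      (∀ f ∈ outer G n u, v P ∈ f ∨ v Q ∈ f → c f ≠ k) ∧
      (∀ f ∈ outer G n u, ∀ g ∈ outer G n u, v P ∈ f → v Q ∈ g → c f ≠ 0 → c f ≠ c g) ∧
      (k = 0 → (G.neighborSet (v P)).ncard = 3 ∧ (G.neighborSet (v Q)).ncard = 3) ∧
      (k ≠ 0 → ∀ f ∈ outer G n u, ∀ a ∈ f, G.Adj (v P) a ∨ G.Adj (v Q) a → c f ≠ k) := by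
  have hne : v P ≠ v Q := fun h => hPQ (C.vinj P hP Q hQ hstP hstQ h)
  obtain ⟨H, hH⟩ : ∃ H, H = fromEdgeSet (insert s(v P, v Q) (outer G n u)) := ⟨_, rfl⟩
  have hes : H.edgeSet = insert s(v P, v Q) (outer G n u) := by
    rw [hH, edgeSet_fromEdgeSet, sdiff_eq_left, Set.disjoint_left]
    rintro f (rfl | hf) hd
    · exact hne (Sym2.mk_isDiag_iff.1 hd)
    · exact G.not_isDiag_of_mem_edgeSet hf.1 hd
  have hadj : ∀ x y, H.Adj x y ↔ s(x, y) = s(v P, v Q) ∨ s(x, y) ∈ outer G n u := fun x y => by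
    rw [← mem_edgeSet, hes, Set.mem_insert_iff]
  have hO : outer G n u ⊆ H.edgeSet := by
    rw [hes]
    exact Set.subset_insert _ _
  have hX : s(v P, v Q) ∈ H.edgeSet := by
    rw [hes]
    exact Set.mem_insert _ _
  have hXO : s(v P, v Q) ∉ outer G n u := fun h => hv h.1
  have hvdeg : ∀ {i j}, i < n → st i ≠ 2 →
      (∀ z, H.Adj (v i) z → z = v j ∨ s(v i, z) ∈ outer G n u) →
      (H.neighborSet (v i)).ncard ≤ (G.neighborSet (v i)).ncard := by
    intro i j hi hsti h
    have h1 : H.neighborSet (v i) ⊆ insert (v j) (G.neighborSet (v i) \ {u i}) := by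
      intro z hz
      rcases h z hz with rfl | h
      · exact Or.inl rfl
      · exact Or.inr ⟨h.1, (adj_and_ne_of_mem_outer hi h).2.2⟩
    have h2 := Set.ncard_le_ncard h1 (Set.toFinite _)
    have h3 := Set.ncard_insert_le (v j) (G.neighborSet (v i) \ {u i})
    have h4 := Set.ncard_sdiff_singleton_add_one
      (show u i ∈ G.neighborSet (v i) from (C.leave i hi hsti).symm) (Set.toFinite _)
    omega
  have hPkey : IsKey n E st (P, P) := Or.inr ⟨rfl, hP, hstP⟩
  have hQkey : IsKey n E st (Q, Q) := Or.inr ⟨rfl, hQ, hstQ⟩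
  obtain ⟨c, hc, hc'⟩ := hG.exists_partialGood hO (fun x => by
      by_cases hxP : x = v P
      · subst hxP
        refine hvdeg (j := Q) hP hstP fun z hz => ((hadj _ _).1 hz).imp_left fun h => ?_
        simpa [hne] using h
      · by_cases hxQ : x = v Q
        · subst hxQ
          refine hvdeg (j := P) hQ hstQ fun z hz => ((hadj _ _).1 hz).imp_left fun h => ?_
          simpa [hne.symm] using h
        · refine Set.ncard_le_ncard (fun z hz => ?_) (Set.toFinite _)
          rcases (hadj _ _).1 hz with h | h
          · simp [hxP, hxQ] at h
          · exact h.1) (by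
      have h1 : insert s(u P, v P) (insert s(u Q, v Q) (outer G n u)) ⊆ G.edgeSet := by
        rintro f (rfl | rfl | hf)
        · exact C.leave P hP hstP
        · exact C.leave Q hQ hstQ
        · exact hf.1
      have h2 := Set.ncard_le_ncard h1 (Set.toFinite _)
      have h3 := Set.ncard_insert_le s(v P, v Q) (outer G n u)
      rw [Set.ncard_insert_of_notMem, Set.ncard_insert_of_notMem] at h2
      · rw [hes]
        omega
      · exact edgeOf_self (u := u) (v := v) Q ▸ C.edgeOf_notMem_outer hQkey
      · rintro (h | h)
        · rw [← edgeOf_self, ← edgeOf_self] at h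
          have := C.edgeOf_inj hPkey hQkey h
          simp [hPQ] at this
        · exact C.edgeOf_notMem_outer hPkey (edgeOf_self (u := u) (v := v) P ▸ h))
  have hXne : ∀ f ∈ outer G n u, s(v P, v Q) ≠ f := fun f hf h => hXO (h ▸ hf)
  refine ⟨c, hc', c s(v P, v Q), ?_, ?_, ?_, ?_, ?_⟩
  · intro i hi hst hik f hf hvf h0
    by_cases hPQi : i ≠ P ∧ i ≠ Q
    · have hvP : v i ≠ v P := fun h => hPQi.1 (C.vinj i hi P hP (by omega) hstP h)
      have hvQ : v i ≠ v Q := fun h => hPQi.2 (C.vinj i hi Q hQ (by omega) hstQ h)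
      have h1 := hc.2 f (hO hf) h0 _ hvf
      have h2 := ncard_neighborSet_lt_of_forall (C.leave i hi (by omega)).symm fun z hz => by
        rcases (hadj _ _).1 hz with h | h
        · simp [hvP, hvQ] at h
        · exact ⟨h.1, (adj_and_ne_of_mem_outer hi h).2.2⟩
      have := C.deg_eq i hi hst
      omega
    · have hk := hik.resolve_left hPQi
      refine hc.ne_of_touch hX (hO hf) (hXne f hf) ⟨v i, ?_, hvf⟩ (hk.trans h0.symm)
      by_cases hiP : i = P
      · simp [hiP]
      · simp [not_and_not_right.1 hPQi hiP]
  · rintro f hf hvf h0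
    refine hc.ne_of_touch hX (hO hf) (hXne f hf) ?_ h0.symm
    rcases hvf with h | h
    · exact ⟨_, by simp, h⟩
    · exact ⟨_, by simp, h⟩
  · intro f hf g hg hPf hQg h0 hfg
    refine (hc.1 f (hO hf) g (hO hg) ?_ hfg).2 h0 ⟨_, hPf, _, hQg, Or.inr hX⟩
    rintro rfl
    exact hXne f hf ((Sym2.mem_and_mem_iff hne).1 ⟨hPf, hQg⟩).symm
  · intro h0
    have h1 := hc.2 _ hX h0
    have hdeg : ∀ i < n, st i ≠ 2 → (H.neighborSet (v i)).ncard = 3 →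
        (∃ j, ∀ z, H.Adj (v i) z → z = v j ∨ s(v i, z) ∈ outer G n u) →
        (G.neighborSet (v i)).ncard = 3 := by
      rintro i hi hst h3 ⟨j, h⟩
      have := hvdeg hi hst h
      have := hG.1 (v i)
      omega
    refine ⟨hdeg P hP hstP (h1 _ (by simp)) ⟨Q, fun z hz => ?_⟩,
      hdeg Q hQ hstQ (h1 _ (by simp)) ⟨P, fun z hz => ?_⟩⟩
    · refine ((hadj _ _).1 hz).imp_left fun h => ?_
      simpa [hne] using h
    · refine ((hadj _ _).1 hz).imp_left fun h => ?_
      simpa [hne.symm] using h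
  · intro h0 f hf a haf ha hfk
    have hout : ∀ i < n, st i ≠ 2 → G.Adj (v i) a → H.Adj (v i) a := by
      intro i hi hst hia
      refine hO (show s(v i, a) ∈ outer G n u from ⟨hia, fun j hj hmem => ?_⟩)
      rcases Sym2.mem_iff.1 hmem with h | h
      · exact C.outside i hi hst j hj h.symm
      · exact hf.2 j hj (h ▸ haf)
    refine (hc.1 _ hX f (hO hf) (hXne f hf) hfk.symm).2 h0 ?_
    rcases ha with ha | ha
    · exact ⟨_, by simp, a, haf, Or.inr (hout P hP hstP ha)⟩
    · exact ⟨_, by simp, a, haf, Or.inr (hout Q hQ hstQ ha)⟩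

end Reductions

/-! ### Soundness of the checks -/

/-- The vertices `u 0, …, u (n - 1)` induce the graph with edge list `E`. -/
structure Emb {V : Type} (G : SimpleGraph V) (n : ℕ) (E : List (ℕ × ℕ)) (u : ℕ → V) : Prop where
  lt : ∀ e ∈ E, e.1 < e.2 ∧ e.2 < n
  inj : ∀ i < n, ∀ j < n, u i = u j → i = j
  adj : ∀ i < n, ∀ j < n, G.Adj (u i) (u j) ↔ joined E i j = true

section Checks

variable {V : Type} {G : SimpleGraph V} {n : ℕ} {E : List (ℕ × ℕ)} {fl : Bool}
  {st : ℕ → ℕ} {u v : ℕ → V} {c : Sym2 V → Fin 8}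

theorem edeg_eq_card (n : ℕ) (E : List (ℕ × ℕ)) (i : ℕ) :
    edeg n E i = ((Finset.range n).filter fun j => joined E i j = true).card := by
  rw [edeg, ← List.toFinset_card_of_nodup (List.nodup_range.filter _), List.toFinset_filter]
  congr 1
  ext
  simp

theorem Emb.edeg_add_ncard_le [Finite V] (M : Emb G n E u) {i : ℕ} (hi : i < n) {S : Set V}
    (hS : S ⊆ G.neighborSet (u i)) (hSu : ∀ x ∈ S, ∀ j < n, x ≠ u j) :
    edeg n E i + S.ncard ≤ (G.neighborSet (u i)).ncard := by
  classical
  have h1 : u '' ((Finset.range n).filter fun j => joined E i j = true) ⊆ G.neighborSet (u i) := by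
    rintro _ ⟨j, hj, rfl⟩
    simp only [Finset.coe_filter, Finset.mem_range, Set.mem_ofPred_eq] at hj
    exact (M.adj i hi j hj.1).2 hj.2
  have h2 : (u '' ((Finset.range n).filter fun j => joined E i j = true)).ncard = edeg n E i := by
    rw [Set.InjOn.ncard_image, Set.ncard_coe_finset, edeg_eq_card]
    intro j hj k hk hjk
    simp only [Finset.coe_filter, Finset.mem_range, Set.mem_ofPred_eq] at hj hk
    exact M.inj j hj.1 k hk.1 hjk
  rw [← h2, ← Set.ncard_union_eq _ (Set.toFinite _) (Set.toFinite _)]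
  · exact Set.ncard_le_ncard (Set.union_subset h1 hS) (Set.toFinite _)
  · rw [Set.disjoint_left]
    rintro _ ⟨j, hj, rfl⟩ hx
    simp only [Finset.coe_filter, Finset.mem_range, Set.mem_ofPred_eq] at hj
    exact hSu _ hx j hj.1 rfl

theorem Config.edeg_le [Finite V] (C : Config G n E fl st u v) {i : ℕ} (hi : i < n) :
    (bif st i == 2 then edeg n E i else edeg n E i + 1) ≤ (G.neighborSet (u i)).ncard := by
  have M : Emb G n E u := ⟨C.lt, C.inj, C.adj⟩
  by_cases hst : st i = 2
  · rw [hst, show (2 == 2) = true from rfl, cond_true]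
    exact (Nat.le_add_right _ _).trans (M.edeg_add_ncard_le hi (Set.empty_subset _) (by simp))
  · rw [beq_eq_false_iff_ne.2 hst, cond_false, ← Set.ncard_singleton (v i)]
    exact M.edeg_add_ncard_le hi (by simpa using C.leave i hi hst)
      (by simpa using C.outside i hi hst)

theorem Config.ncard_eq_three [Finite V] (hG : Subcubic G) (C : Config G n E fl st u v) {i : ℕ}
    (hi : i < n) (h : full n E st i = true) : (G.neighborSet (u i)).ncard = 3 := by
  have h1 := C.edeg_le hi
  rw [beq_iff_eq.1 h] at h1
  exact (hG _).antisymm h1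

theorem Config.ncard_sideColors_le [Finite V] (hG : Subcubic G) (C : Config G n E fl st u v) {i : ℕ}
    (hi : i < n) (hst : st i ≠ 2) :
    (sideColors G (outer G n u) c (u i) (v i)).ncard ≤ 2 - st i := by
  have := C.st_le i hi
  have hl := C.leave i hi hst
  rcases Nat.lt_or_ge 0 (st i) with h | h
  · have h1 : st i = 1 := by omega
    have := ncard_sideColors_le_one (O := outer G n u) (c := c) hG hl
      (Or.inl (by have := C.deg_le i hi h1; omega))
    omega
  · have := ncard_sideColors_le_two (O := outer G n u) (c := c) hG hl
    omega

/-- A small set of colors avoiding `B` is contained in one of prescribed size. -/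
theorem exists_finset_card_eq {S : Set (Fin 8)} {B : Finset (Fin 8)} {r : ℕ} (hS : S.ncard ≤ r)
    (hSB : ∀ x ∈ S, x ∉ B) (hB : r + B.card ≤ 8) :
    ∃ A : Finset (Fin 8), A.card = r ∧ (∀ x ∈ S, x ∈ A) ∧ ∀ x ∈ A, x ∉ B := by
  classical
  have h1 : S.toFinite.toFinset ⊆ Bᶜ := fun x hx => by
    rw [Finset.mem_compl]
    exact hSB x (S.toFinite.mem_toFinset.1 hx)
  obtain ⟨A, hA1, hA2, hA3⟩ := Finset.exists_subsuperset_card_eq (n := r) h1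
    (by rwa [← Set.ncard_eq_toFinset_card]) (by rw [Finset.card_compl, Fintype.card_fin]; omega)
  exact ⟨A, hA3, fun x hx => hA1 (S.toFinite.mem_toFinset.2 hx),
    fun x hx => Finset.mem_compl.1 (hA2 hx)⟩

theorem ne_zero_of_mem_sideColors {O : Set (Sym2 V)} {x y : V} {k : Fin 8}
    (h : k ∈ sideColors G O c x y) : k ≠ 0 := by
  obtain ⟨z, hz, rfl⟩ := h
  exact hz.2.2.2

theorem Config.mem_keys (C : Config G n E fl st u v) {e : ℕ × ℕ} :
    e ∈ keys n E st ↔ IsKey n E st e := by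
  have := C.st_le
  simp only [keys, List.mem_append, List.mem_map, List.mem_filter, List.mem_range, beq_iff_eq,
    IsKey]
  constructor
  · rintro ((⟨i, ⟨hi, h⟩, rfl⟩ | ⟨i, ⟨hi, h⟩, rfl⟩) | h)
    · exact Or.inr ⟨rfl, hi, by simp [h]⟩
    · exact Or.inr ⟨rfl, hi, by simp [h]⟩
    · exact Or.inl h
  · rintro (h | ⟨h1, h2, h3⟩)
    · exact Or.inr h
    · obtain ⟨i, j⟩ := e
      obtain rfl : i = j := h1
      have := this i h2
      rcases Nat.lt_or_ge 0 (st i) with h | h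
      · exact Or.inl (Or.inr ⟨i, ⟨h2, by simp only at h3; omega⟩, rfl⟩)
      · exact Or.inl (Or.inl ⟨i, ⟨h2, by omega⟩, rfl⟩)

theorem Config.nodup_keys (C : Config G n E fl st u v) (hE : E.Nodup) : (keys n E st).Nodup := by
  have hinj : Function.Injective fun i : ℕ => (i, i) := fun i j h => congrArg Prod.fst h
  rw [keys, List.nodup_append, List.nodup_append]
  refine ⟨⟨(List.nodup_range.filter _).map hinj, (List.nodup_range.filter _).map hinj, ?_⟩, hE, ?_⟩
  · rintro a ha b hb rfl
    simp only [List.mem_map, List.mem_filter, beq_iff_eq] at ha hb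
    obtain ⟨i, ⟨-, hi⟩, rfl⟩ := ha
    obtain ⟨j, ⟨-, hj⟩, h⟩ := hb
    cases h
    omega
  · rintro a ha b hb rfl
    have := C.lt a hb
    simp only [List.mem_append, List.mem_map] at ha
    rcases ha with ⟨i, -, rfl⟩ | ⟨i, -, rfl⟩ <;> exact absurd this.1 (lt_irrefl _)

theorem mem_ends {p : ℕ × ℕ} : p ∈ ends n st ↔ p.1 < n ∧ st p.1 ≠ 2 ∧ p.2 = 2 - st p.1 := by
  obtain ⟨i, r⟩ := p
  simp only [ends, List.mem_map, List.mem_filter, List.mem_range, Bool.not_eq_true',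
    beq_eq_false_iff_ne, Prod.mk.injEq]
  constructor
  · rintro ⟨j, ⟨h1, h2⟩, rfl, rfl⟩
    exact ⟨h1, h2, rfl⟩
  · rintro ⟨h1, h2, rfl⟩
    exact ⟨i, ⟨h1, h2⟩, rfl, rfl⟩

theorem Config.of_allowed [Finite V] (hG : Subcubic G) (C : Config G n E fl st u v) {f : ℕ × ℕ}
    (hf : IsKey n E st f) {k : Fin 8} (h : allowed n E st f k = true) (hk : k = 0) :
    (G.neighborSet (u f.1)).ncard = 3 ∧ (G.neighborSet (u f.2)).ncard = 3 ∧
      (f.1 = f.2 → st f.1 = 0) := by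
  subst hk
  simp only [allowed, Fin.val_zero, beq_self_eq_true, Bool.not_true, Bool.false_or,
    Bool.and_eq_true, Bool.or_eq_true, Bool.not_eq_true', beq_eq_false_iff_ne, beq_iff_eq] at h
  obtain ⟨⟨h1, h2⟩, h3⟩ := h
  have hlt : f.1 < n ∧ f.2 < n := by
    rcases hf with hf | hf
    · have := C.lt f hf
      omega
    · omega
  exact ⟨C.ncard_eq_three hG hlt.1 h1, C.ncard_eq_three hG hlt.2 h2, fun h => h3.resolve_left (· h)⟩

/-- Sets containing the colors at the vertices `v i`. -/
theorem Config.exists_sets [Finite V] (hG : Subcubic G) (C : Config G n E fl st u v)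
    (c : Sym2 V → Fin 8) : ∃ A : ℕ → Finset (Fin 8), ∀ i, 0 ∉ A i ∧
      (i < n → st i ≠ 2 → (A i).card = 2 - st i ∧
        ∀ f ∈ outer G n u, v i ∈ f → c f ≠ 0 → c f ∈ A i) ∧
      (¬(i < n ∧ st i ≠ 2) → A i = ∅) := by
  have key : ∀ i, ∃ A : Finset (Fin 8), 0 ∉ A ∧ (i < n → st i ≠ 2 → A.card = 2 - st i ∧
      ∀ f ∈ outer G n u, v i ∈ f → c f ≠ 0 → c f ∈ A) ∧ (¬(i < n ∧ st i ≠ 2) → A = ∅) := by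
    intro i
    by_cases h : i < n ∧ st i ≠ 2
    · obtain ⟨A, h1, h2, h3⟩ := exists_finset_card_eq (B := {0})
        (C.ncard_sideColors_le (c := c) hG h.1 h.2)
        (fun x hx => by simpa using ne_zero_of_mem_sideColors hx) (by simp; omega)
      refine ⟨A, fun h0 => by simpa using h3 0 h0, fun _ _ => ⟨h1, fun f hf hvf h0 => ?_⟩,
        fun h' => absurd h h'⟩
      exact h2 _ (mem_sideColors outer_subset hf hvf (hf.2 i h.1) h0)
    · exact ⟨∅, by simp, fun h1 h2 => absurd ⟨h1, h2⟩ h, fun _ => rfl⟩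
  choose A hA using key
  exact ⟨A, hA⟩

/-- A configuration passing the check does not occur. -/
theorem Config.false_of_check [Finite V] (hG : MinCounter V G) (C : Config G n E fl st u v)
    (hE : E ≠ []) (hnd : E.Nodup) (h : check n E fl st = true) : False := by
  obtain ⟨c, hc, hz⟩ := C.exists_partialGood hG hE
  obtain ⟨A, hA⟩ := C.exists_sets hG.1 c
  have hA' : ∀ i, (∀ p ∈ ends n st, p.1 ≠ i) → A i = ∅ := fun i hi => (hA i).2.2 fun hi' =>
    hi (i, 2 - st i) (mem_ends.2 ⟨hi'.1, hi'.2, rfl⟩) rfl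
  refine hG.2.1 (C.exists_of_start hG.1 h (D := ∅) (c := c) (by simp)
    (fun e he => C.mem_keys.1 he) (C.nodup_keys hnd) (by simp)
    (fun e he => Or.inr (C.mem_keys.2 he)) (by simpa using hc) A
    (fun i hi hst => ((hA i).2.1 hi hst).2) (fun i hi hst _ => hz i hi hst) (fun i => (hA i).1)
    (fun p hp => ?_) (fun i hi => by simp [hA' i hi]) (by simp) fun f hf k hk => ⟨?_, ?_, by simp⟩)
  · obtain ⟨h1, h2, h3⟩ := mem_ends.1 hp
    have := C.st_le _ h1
    exact ⟨((hA p.1).2.1 h1 h2).1.trans h3.symm, by omega⟩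
  · exact C.of_allowed hG.1 (C.mem_keys.1 hf) hk
  · exact fun i hi _ => by simp [hA' i hi]

end Checks

section AddedEdge

variable {V : Type} {G : SimpleGraph V} {n : ℕ} {E : List (ℕ × ℕ)} {fl : Bool}
  {st : ℕ → ℕ} {u v : ℕ → V} {P Q : ℕ}

theorem exists_perm_of_disjoint {A B : Finset (Fin 8)} {k : Fin 8} (hA : ∀ x ∈ A, x ≠ 0 ∧ x ≠ k)
    (hB : ∀ x ∈ B, x ∉ insert k (insert 0 A)) :
    ∃ σ : Equiv.Perm (Fin 8), σ 0 = 0 ∧ (∀ x ∈ A, (σ x : ℕ) ≤ A.card) ∧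
      (∀ x ∈ B, A.card < (σ x : ℕ) ∧ (σ x : ℕ) ≤ A.card + B.card) ∧
      (k ≠ 0 → (σ k : ℕ) = A.card + B.card + 1) := by
  simp only [Finset.mem_insert, not_or] at hB
  have hBA : ∀ x ∈ A, x ∉ B := fun x hx hxB => (hB x hxB).2.2 hx
  obtain ⟨zs, hzs⟩ : ∃ zs, zs = if k = 0 then [] else [k] := ⟨_, rfl⟩
  have hz : ∀ x, x ∈ zs ↔ k ≠ 0 ∧ x = k := by
    intro x
    by_cases hk : k = 0 <;> simp [hzs, hk]
  obtain ⟨σ, hσ, hmap⟩ := exists_perm_map_eq_range' 0 (A.toList ++ (B.toList ++ zs)) (by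
      rw [List.nodup_append, List.nodup_append]
      refine ⟨A.nodup_toList, ⟨B.nodup_toList, by by_cases hk : k = 0 <;> simp [hzs, hk], ?_⟩, ?_⟩
      · rintro x hx y hy rfl
        exact (hB x (Finset.mem_toList.1 hx)).1 ((hz x).1 hy).2
      · rintro x hx y hy rfl
        rw [Finset.mem_toList] at hx
        rcases List.mem_append.1 hy with hy | hy
        · exact hBA x hx (Finset.mem_toList.1 hy)
        · exact (hA x hx).2 ((hz x).1 hy).2) (by
      intro x hx
      refine Nat.pos_of_ne_zero fun h => ?_
      have h0 : x = 0 := Fin.ext h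
      simp only [List.mem_append, Finset.mem_toList, hz] at hx
      rcases hx with hx | hx | hx
      · exact (hA x hx).1 h0
      · exact (hB x hx).2.1 h0
      · exact hx.1 (hx.2.symm.trans h0))
  rw [List.length_append, List.length_append, List.map_append, List.map_append,
    ← List.range'_append_1, ← List.range'_append_1] at hmap
  obtain ⟨h1, h2⟩ := List.append_inj hmap (by simp)
  obtain ⟨h2, h3⟩ := List.append_inj h2 (by simp)
  simp only [Finset.length_toList] at h1 h2 h3
  refine ⟨σ, hσ 0 le_rfl, fun x hx => ?_, fun x hx => ?_, fun hk => ?_⟩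
  · have := List.mem_map_of_mem (f := fun x => (σ x : ℕ)) (Finset.mem_toList.2 hx)
    rw [h1, List.mem_range'_1] at this
    omega
  · have := List.mem_map_of_mem (f := fun x => (σ x : ℕ)) (Finset.mem_toList.2 hx)
    rw [h2, List.mem_range'_1] at this
    omega
  · have := List.mem_map_of_mem (f := fun x => (σ x : ℕ)) ((hz k).2 ⟨hk, rfl⟩)
    rw [h3, List.mem_range'_1] at this
    simp only [hzs, if_neg hk, List.length_singleton] at this
    omega

/-- The normalized coloring obtained by replacing the configuration by an edge. -/
theorem Config.exists_sets_add [Finite V] (hG : MinCounter V G) (C : Config G n E fl st u v)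
    (hP : P < n) (hQ : Q < n) (hPQ : P ≠ Q) (hstP : st P ≠ 2) (hstQ : st Q ≠ 2)
    (hv : ¬G.Adj (v P) (v Q)) : ∃ (c : Sym2 V → Fin 8) (k : Fin 8) (A : ℕ → Finset (Fin 8)),
      PartialGood G (outer G n u) c ∧
      (∀ i < n, st i = 0 → (i ≠ P ∧ i ≠ Q) ∨ k = 0 → ∀ f ∈ outer G n u, v i ∈ f → c f ≠ 0) ∧
      (k = 0 → (G.neighborSet (v P)).ncard = 3 ∧ (G.neighborSet (v Q)).ncard = 3) ∧
      (k ≠ 0 → ∀ f ∈ outer G n u, ∀ a ∈ f,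
        a = v P ∨ a = v Q ∨ G.Adj (v P) a ∨ G.Adj (v Q) a → c f ≠ k) ∧
      (∀ i, 0 ∉ A i) ∧
      (∀ i < n, st i ≠ 2 → (A i).card = 2 - st i ∧
        ∀ f ∈ outer G n u, v i ∈ f → c f ≠ 0 → c f ∈ A i) ∧
      (∀ i, ¬(i < n ∧ st i ≠ 2) → A i = ∅) ∧
      (∀ x ∈ A P, (x : ℕ) ≤ 2 - st P) ∧
      (∀ x ∈ A Q, 2 - st P < (x : ℕ) ∧ (x : ℕ) ≤ 2 - st P + (2 - st Q)) ∧
      (k ≠ 0 → (k : ℕ) = 2 - st P + (2 - st Q) + 1) := by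
  classical
  obtain ⟨c, hc, k, hz, hk, hdis, hdeg, hnear⟩ :=
    C.exists_partialGood_add hG hP hQ hPQ hstP hstQ hv
  obtain ⟨A, hA⟩ := C.exists_sets hG.1 c
  have hcol : ∀ {i x}, x ∈ sideColors G (outer G n u) c (u i) (v i) →
      ∃ f ∈ outer G n u, v i ∈ f ∧ c f = x := by
    rintro i x ⟨y, hy, rfl⟩
    exact ⟨_, hy.2.2.1, by simp, rfl⟩
  have hmem : ∀ {i}, i < n → ∀ f ∈ outer G n u, v i ∈ f → c f ≠ 0 →
      c f ∈ sideColors G (outer G n u) c (u i) (v i) := fun hi f hf hvf h0 =>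
    mem_sideColors outer_subset hf hvf (hf.2 _ hi) h0
  have hSP := C.ncard_sideColors_le (c := c) hG.1 hP hstP
  have hSQ := C.ncard_sideColors_le (c := c) hG.1 hQ hstQ
  have hSQ' := hSQ
  rw [Set.ncard_eq_toFinset_card _ (Set.toFinite _)] at hSQ'
  obtain ⟨AP, hAP, hAP1, hAP2⟩ := exists_finset_card_eq
    (B := insert k (insert 0 (Set.toFinite (sideColors G (outer G n u) c (u Q) (v Q))).toFinset))
      hSP
    (fun x hx => by
      obtain ⟨f, hf, hvf, rfl⟩ := hcol hx
      have h0 := ne_zero_of_mem_sideColors hx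
      simp only [Finset.mem_insert, Set.Finite.mem_toFinset, not_or]
      refine ⟨hk f hf (Or.inl hvf), h0, fun hmemQ => ?_⟩
      obtain ⟨g, hg, hvg, hgf⟩ := hcol hmemQ
      exact hdis f hf g hg hvf hvg h0 hgf.symm) (by
      have h1 := Finset.card_insert_le k
        (insert 0 (Set.toFinite (sideColors G (outer G n u) c (u Q) (v Q))).toFinset)
      have h2 := Finset.card_insert_le 0
        (Set.toFinite (sideColors G (outer G n u) c (u Q) (v Q))).toFinset
      omega)
  simp only [Finset.mem_insert, Set.Finite.mem_toFinset, not_or] at hAP2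
  obtain ⟨AQ, hAQ, hAQ1, hAQ2⟩ := exists_finset_card_eq (B := insert k (insert 0 AP)) hSQ
    (fun x hx => by
      obtain ⟨f, hf, hvf, hfx⟩ := hcol hx
      simp only [Finset.mem_insert, not_or]
      exact ⟨hfx ▸ hk f hf (Or.inr hvf), ne_zero_of_mem_sideColors hx, fun h => (hAP2 x h).2.2 hx⟩)
    (by
      have h1 := Finset.card_insert_le k (insert 0 AP)
      have h2 := Finset.card_insert_le 0 AP
      omega)
  obtain ⟨σ, hσ0, hσP, hσQ, hσk⟩ := exists_perm_of_disjoint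
    (fun x hx => ⟨(hAP2 x hx).2.1, (hAP2 x hx).1⟩) hAQ2
  simp only [Finset.mem_insert, not_or] at hAQ2
  rw [hAP] at hσP
  rw [hAP, hAQ] at hσQ hσk
  have hσz : ∀ x, σ x = 0 ↔ x = 0 := fun x =>
    ⟨fun h => σ.injective (h.trans hσ0.symm), fun h => h ▸ hσ0⟩
  obtain ⟨A', hA'⟩ : ∃ A', A' = Function.update (Function.update A P AP) Q AQ := ⟨_, rfl⟩
  have hAP' : A' P = AP := by simp [hA', hPQ]
  have hAQ' : A' Q = AQ := by simp [hA']
  have hAi' : ∀ i, i ≠ P → i ≠ Q → A' i = A i := fun i h1 h2 => by simp [hA', h1, h2]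
  refine ⟨fun f => σ (c f), σ k, fun i => (A' i).map σ.toEmbedding, hc.comp_perm σ hσ0,
    fun i hi hst hik f hf hvf h0 => ?_, fun h0 => hdeg ((hσz k).1 h0),
      fun h0 f hf a haf ha hfk => ?_,
    fun i hi0 => ?_, fun i hi hst => ?_, fun i hi => ?_, fun x hx => ?_, fun x hx => ?_,
    fun h0 => hσk fun h => h0 ((hσz k).2 h)⟩
  · exact hz i hi hst (hik.imp_right (hσz k).1) f hf hvf ((hσz _).1 h0)
  · have h0' : k ≠ 0 := fun h => h0 ((hσz k).2 h)
    have hfk' := σ.injective hfk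
    rcases ha with rfl | rfl | ha
    · exact hk f hf (Or.inl haf) hfk'
    · exact hk f hf (Or.inr haf) hfk'
    · exact hnear h0' f hf a haf ha hfk'
  · obtain ⟨x, hx, hx0⟩ := Finset.mem_map.1 hi0
    have hx0 : x = 0 := (hσz x).1 hx0
    subst hx0
    by_cases h1 : i = Q
    · subst h1
      rw [hAQ'] at hx
      exact (hAQ2 0 hx).2.1 rfl
    · by_cases h2 : i = P
      · subst h2
        rw [hAP'] at hx
        exact (hAP2 0 hx).2.1 rfl
      · rw [hAi' i h2 h1] at hx
        exact (hA i).1 hx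
  · show ((A' i).map σ.toEmbedding).card = 2 - st i ∧ ∀ f ∈ outer G n u, v i ∈ f →
      σ (c f) ≠ 0 → σ (c f) ∈ (A' i).map σ.toEmbedding
    rw [Finset.card_map]
    by_cases h1 : i = Q
    · subst h1
      rw [hAQ']
      exact ⟨hAQ, fun f hf hvf h0 => Finset.mem_map_of_mem σ.toEmbedding
        (hAQ1 _ (hmem hi f hf hvf fun h => h0 ((hσz _).2 h)))⟩
    · by_cases h2 : i = P
      · subst h2
        rw [hAP']
        exact ⟨hAP, fun f hf hvf h0 => Finset.mem_map_of_mem σ.toEmbedding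
          (hAP1 _ (hmem hi f hf hvf fun h => h0 ((hσz _).2 h)))⟩
      · rw [hAi' i h2 h1]
        obtain ⟨h3, h4⟩ := (hA i).2.1 hi hst
        exact ⟨h3, fun f hf hvf h0 => Finset.mem_map_of_mem σ.toEmbedding
          (h4 f hf hvf fun h => h0 ((hσz _).2 h))⟩
  · show (A' i).map σ.toEmbedding = ∅
    rw [hAi' i (by rintro rfl; exact hi ⟨hP, hstP⟩) (by rintro rfl; exact hi ⟨hQ, hstQ⟩),
      (hA i).2.2 hi, Finset.map_empty]
  · obtain ⟨y, hy, rfl⟩ := Finset.mem_map.1 hx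
    exact hσP y (hAP' ▸ hy)
  · obtain ⟨y, hy, rfl⟩ := Finset.mem_map.1 hx
    exact hσQ y (hAQ' ▸ hy)

end AddedEdge

section CheckAdd

variable {V : Type} {G : SimpleGraph V} {n : ℕ} {E : List (ℕ × ℕ)} {st : ℕ → ℕ} {u v : ℕ → V}
  {P Q : ℕ} {fl : Bool}

theorem Config.not_near_leaving (C : Config G n E fl st u v) (hP : P < n) (hQ : Q < n)
    (hPQ : P ≠ Q) (hj : joined E P Q = false) (hstP : st P ≠ 2) (hstQ : st Q ≠ 2)
    (hv : ¬G.Adj (v P) (v Q)) : ¬Near G s(u Q, v Q) s(u P, v P) := by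
  have hcross : ∀ {i j}, i < n → j < n → i ≠ j → st i ≠ 2 → st j ≠ 2 → ¬G.Adj (u i) (v j) := by
    intro i j hi hj hij hsti hstj h
    rcases C.nbr i hi _ h with ⟨m, hm, h⟩ | ⟨-, h⟩
    · exact C.outside j hj hstj m hm h
    · exact hij (C.vinj i hi j hj hsti hstj h.symm)
  have hu : ¬G.Adj (u P) (u Q) := fun h => by simp [(C.adj P hP Q hQ).1 h] at hj
  rintro ⟨a, ha, b, hb, hab⟩
  rcases Sym2.mem_iff.1 ha with rfl | rfl <;> rcases Sym2.mem_iff.1 hb with rfl | rfl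
  · exact hab.elim (fun h => hPQ (C.inj Q hQ P hP h).symm) fun h => hu h.symm
  · exact hab.elim (fun h => C.outside P hP hstP Q hQ h.symm) (hcross hQ hP hPQ.symm hstQ hstP)
  · exact hab.elim (C.outside Q hQ hstQ P hP) fun h => hcross hP hQ hPQ hstP hstQ h.symm
  · exact hab.elim (fun h => hPQ (C.vinj Q hQ P hP hstQ hstP h).symm) fun h => hv h.symm

open Classical in
/-- Both leaving edges receive the color of the added edge. -/
theorem Config.partialGood_update (C : Config G n E fl st u v) (hP : P < n) (hQ : Q < n)
    (hPQ : P ≠ Q) (hj : joined E P Q = false) (hstP : st P ≠ 2) (hstQ : st Q ≠ 2)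
    (hv : ¬G.Adj (v P) (v Q)) {c : Sym2 V → Fin 8} {k : Fin 8}
    (hc : PartialGood G (outer G n u) c) (hk0 : k ≠ 0)
    (hk : ∀ f ∈ outer G n u, ∀ a ∈ f, a = v P ∨ a = v Q ∨ G.Adj (v P) a ∨ G.Adj (v Q) a → c f ≠ k) :
    PartialGood G (insert s(u Q, v Q) (insert s(u P, v P) (outer G n u)))
      (Function.update (Function.update c s(u P, v P) k) s(u Q, v Q) k) := by
  have hkey : ∀ {i}, i < n → st i ≠ 2 → IsKey n E st (i, i) := fun hi hst => Or.inr ⟨rfl, hi, hst⟩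
  have hout : ∀ {i}, i < n → st i ≠ 2 → s(u i, v i) ∉ outer G n u := fun {i} hi hst =>
    edgeOf_self (u := u) (v := v) i ▸ C.edgeOf_notMem_outer (hkey hi hst)
  have hfar : ∀ {i}, i < n → st i ≠ 2 → i = P ∨ i = Q → ∀ f ∈ outer G n u, c f = k →
      ¬Near G s(u i, v i) f := by
    intro i hi hst hiPQ f hf hfk hnear
    rw [← edgeOf_self] at hnear
    rcases C.near_outer (hkey hi hst) hf hnear with ⟨j, -, -, hj, hvf⟩ | ⟨j, -, -, hj, y, hy, hvy⟩
    · obtain rfl : j = i := hj.elim id id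
      refine hk f hf _ hvf ?_ hfk
      rcases hiPQ with rfl | rfl <;> simp
    · obtain rfl : i = j := congrArg Prod.fst hj
      refine hk f hf _ hy ?_ hfk
      rcases hiPQ with rfl | rfl <;> simp [hvy]
  have hne : s(u Q, v Q) ≠ s(u P, v P) := by
    intro h
    rw [← edgeOf_self, ← edgeOf_self] at h
    exact hPQ (congrArg Prod.fst (C.edgeOf_inj (hkey hQ hstQ) (hkey hP hstP) h)).symm
  refine PartialGood.insert_update (hc.insert_update (hout hP hstP) (fun h => absurd h hk0)
    fun f hf hfk => ⟨fun h => absurd h hk0, fun _ => hfar hP hstP (Or.inl rfl) f hf hfk⟩)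
    (fun h => h.elim hne (hout hQ hstQ)) (fun h => absurd h hk0)
    fun f hf hfk => ⟨fun h => absurd h hk0, fun _ => ?_⟩
  rcases hf with rfl | hf
  · exact C.not_near_leaving hP hQ hPQ hj hstP hstQ hv
  · rw [Function.update_of_ne (by rintro rfl; exact hout hP hstP hf)] at hfk
    exact hfar hQ hstQ (Or.inr rfl) f hf hfk

/-- If the check with an added edge succeeds, then this edge is already present. -/
theorem Config.adj_of_checkAdd [Finite V] (hG : MinCounter V G) (C : Config G n E false st u v)
    (hE : E ≠ []) (hnd : E.Nodup) (hP : P < n) (hQ : Q < n) (hPQ : P ≠ Q)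
    (hj : joined E P Q = false) (h : checkAdd n E P Q st = true) :
    st P ≠ 2 ∧ st Q ≠ 2 ∧ G.Adj (v P) (v Q) := by
  classical
  by_cases hst : st P = 2 ∨ st Q = 2
  · refine (C.false_of_check hG hE hnd ?_).elim
    rcases hst with h0 | h0 <;> simpa [checkAdd, h0] using h
  obtain ⟨hstP, hstQ⟩ := not_or.1 hst
  refine ⟨hstP, hstQ, by_contra fun hv => hG.2.1 ?_⟩
  obtain ⟨c, k, A, hc, hz, hdeg, hk, hA0, hA, hAe, hAP, hAQ, hkm⟩ :=
    C.exists_sets_add hG hP hQ hPQ hstP hstQ hv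
  rw [checkAdd, show (st P == 2 || st Q == 2) = false by simp [hstP, hstQ], cond_false,
    Bool.and_eq_true] at h
  obtain ⟨h0, h1⟩ := h
  obtain ⟨vs, hvs⟩ : ∃ vs, vs = (ends n st).filter fun e => !(e.1 == P) && !(e.1 == Q) := ⟨_, rfl⟩
  rw [← hvs] at h0 h1
  have hmem : ∀ p, p ∈ vs ↔ (p.1 < n ∧ st p.1 ≠ 2 ∧ p.2 = 2 - st p.1) ∧ p.1 ≠ P ∧ p.1 ≠ Q := by
    intro p
    simp [hvs, mem_ends]
  have hAvs : ∀ p ∈ vs, (A p.1).card = p.2 ∧ (p.2 = 1 ∨ p.2 = 2) := by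
    intro p hp
    obtain ⟨⟨h1, h2, h3⟩, -⟩ := (hmem p).1 hp
    have := C.st_le _ h1
    exact ⟨(hA p.1 h1 h2).1.trans h3.symm, by omega⟩
  have hAother : ∀ i, (∀ p ∈ vs, p.1 ≠ i) → i = P ∨ i = Q ∨ A i = ∅ := by
    intro i hi
    by_contra! hne
    refine hi (i, 2 - st i) ((hmem _).2 ⟨?_, hne.1, hne.2.1⟩) rfl
    by_contra hin
    exact hne.2.2.ne_empty (hAe i fun h => hin ⟨h.1, h.2, rfl⟩)
  have hAm : ∀ i, (∀ p ∈ vs, p.1 ≠ i) → ∀ x ∈ A i, (x : ℕ) ≤ 2 - st P + (2 - st Q) := by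
    intro i hi x hx
    rcases hAother i hi with rfl | rfl | h
    · exact (hAP x hx).trans (Nat.le_add_right _ _)
    · exact (hAQ x hx).2
    · simp [h] at hx
  have hok : ∀ f x, (allowed n E st f x &&
      !(avoids st P f && Nat.ble 1 x && Nat.ble x (2 - st P)) &&
      !(avoids st Q f && Nat.ble (2 - st P + 1) x && Nat.ble x (2 - st P + (2 - st Q)))) = true →
      allowed n E st f x = true ∧
      ∀ i, (∀ p ∈ vs, p.1 ≠ i) → avoids st i f = true → ∀ y : Fin 8, (y : ℕ) = x → y ∉ A i := by
    intro f x h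
    simp only [Bool.and_eq_true, Bool.not_eq_true', ← Bool.not_eq_true, Nat.ble_eq] at h
    obtain ⟨⟨ha, hp⟩, hq⟩ := h
    refine ⟨ha, fun i hi hav y hyx hy => ?_⟩
    subst hyx
    have hy0 : (y : ℕ) ≠ 0 := fun h => hA0 i ((Fin.ext h : y = 0) ▸ hy)
    rcases hAother i hi with rfl | rfl | h
    · exact hp ⟨⟨hav, by omega⟩, hAP y hy⟩
    · exact hq ⟨⟨hav, (hAQ y hy).1⟩, (hAQ y hy).2⟩
    · simp [h] at hy
  by_cases hk0 : k = 0
  · have hst0 : ∀ i < n, st i ≠ 2 → (G.neighborSet (v i)).ncard = 3 → st i = 0 := by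
      intro i hi hst h3
      have := C.st_le i hi
      have := C.deg_le i hi
      omega
    rw [show (st P == 0 && st Q == 0) = true by
      simp [hst0 P hP hstP (hdeg hk0).1, hst0 Q hQ hstQ (hdeg hk0).2], Bool.not_true,
      Bool.false_or] at h0
    refine C.exists_of_start hG.1 h0 (D := ∅) (c := c) (by simp)
      (fun e he => C.mem_keys.1 he) (C.nodup_keys hnd) (by simp)
      (fun e he => Or.inr (C.mem_keys.2 he)) (by simpa using hc) A
      (fun i hi hst => (hA i hi hst).2) (fun i hi hst _ => hz i hi hst (Or.inr hk0)) hA0 hAvs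
      hAm (by simp) fun f hf x hx => ?_
    obtain ⟨h3, h4⟩ := hok f x hx
    exact ⟨C.of_allowed hG.1 (C.mem_keys.1 hf) h3, fun i hi hav => h4 i hi hav x rfl, by simp⟩
  · have hupd : ∀ f ∈ outer G n u,
        Function.update (Function.update c s(u P, v P) k) s(u Q, v Q) k f = c f := by
      intro f hf
      rw [Function.update_of_ne, Function.update_of_ne]
      · rintro rfl
        exact hf.2 P hP (by simp)
      · rintro rfl
        exact hf.2 Q hQ (by simp)
    have hcD : ∀ e ∈ ({(P, P), (Q, Q)} : Set (ℕ × ℕ)),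
        Function.update (Function.update c s(u P, v P) k) s(u Q, v Q) k (edgeOf u v e) = k := by
      rintro e (rfl | rfl)
      · rw [edgeOf_self]
        by_cases h : s(u P, v P) = s(u Q, v Q)
        · rw [h, Function.update_self]
        · rw [Function.update_of_ne h, Function.update_self]
      · rw [edgeOf_self, Function.update_self]
    have hl : ∀ e, e ∈ (keys n E st).filter (fun e => !(e == (P, P)) && !(e == (Q, Q))) ↔
        IsKey n E st e ∧ e ≠ (P, P) ∧ e ≠ (Q, Q) := by
      intro e
      rw [List.mem_filter, C.mem_keys]
      simp only [Bool.and_eq_true, Bool.not_eq_true', beq_eq_false_iff_ne]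
    refine C.exists_of_start hG.1 h1 (D := {(P, P), (Q, Q)})
      (c := Function.update (Function.update c s(u P, v P) k) s(u Q, v Q) k) ?_
      (fun e he => ((hl e).1 he).1) ((C.nodup_keys hnd).filter _) ?_ (fun e he => ?_) ?_ A
      (fun i hi hst f hf hvf => ?_) (fun i hi hst hil f hf hvf => ?_) hA0 hAvs
      (fun i hi x hx => (hAm i hi x hx).trans (Nat.le_succ _)) (fun e he => ?_) fun f hf x hx => ?_
    · rintro e (rfl | rfl)
      · exact Or.inr ⟨rfl, hP, hstP⟩
      · exact Or.inr ⟨rfl, hQ, hstQ⟩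
    · rintro e he (rfl | rfl)
      · exact ((hl _).1 he).2.1 rfl
      · exact ((hl _).1 he).2.2 rfl
    · by_cases h1 : e = (P, P)
      · exact Or.inl (Or.inl h1)
      · by_cases h2 : e = (Q, Q)
        · exact Or.inl (Or.inr h2)
        · exact Or.inr ((hl e).2 ⟨he, h1, h2⟩)
    · have := C.partialGood_update hP hQ hPQ hj hstP hstQ hv hc hk0 (hk hk0)
      rwa [Set.image_pair, edgeOf_self, edgeOf_self, Set.union_insert, Set.union_singleton,
        Set.insert_comm]
    · rw [hupd f hf]
      exact (hA i hi hst).2 f hf hvf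
    · rw [hupd f hf]
      have := ((hl _).1 hil).2
      exact hz i hi hst (Or.inl ⟨fun h => this.1 (by rw [h]), fun h => this.2 (by rw [h])⟩) f hf hvf
    · rw [hcD e he, hkm hk0]
    · rw [Bool.and_eq_true] at hx
      obtain ⟨hx, hx'⟩ := hx
      simp only [Bool.not_eq_true', Bool.and_eq_false_iff, beq_eq_false_iff_ne,
        Bool.or_eq_false_iff] at hx'
      obtain ⟨h3, h4⟩ := hok f x hx
      refine ⟨C.of_allowed hG.1 ((hl f).1 hf).1 h3, fun i hi hav => h4 i hi hav x rfl,
        fun e he hex => ?_⟩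
      rw [hcD e he] at hex
      subst hex
      have h5 := hx'.resolve_left (not_not_intro (hkm hk0))
      refine ⟨fun h => absurd h hk0, fun _ => ?_⟩
      rcases he with rfl | rfl
      · exact h5.1
      · exact h5.2

end CheckAdd

/-! ### Closing an induced subgraph under adjacency -/

/-- `p` holds for all lists of at least two and at most three indices of degree at most `2`,
pairwise nonadjacent if `tf` holds. -/
def forallRows (tf : Bool) (n : ℕ) (E : List (ℕ × ℕ)) (p : List ℕ → Bool) : Bool :=
  let l := (List.range n).filter fun i => Nat.ble (edeg n E i) 2
  (l.sublistsLen 2 ++ l.sublistsLen 3).all fun r =>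
    tf && r.any (fun i => r.any fun j => joined E i j) || p r

/-- The induced subgraph with edge list `E`, and its extensions by vertices with at least two
neighbors in the subgraph, pass the check. -/
def close (tf : Bool) : ℕ → ℕ → List (ℕ × ℕ) → Bool
  | 0, _, _ => false
  | k + 1, n, E => !((List.range n).all fun i => Nat.ble (edeg n E i) 3) ||
      ((List.range n).all (fun i => Nat.ble 2 (edeg n E i)) && checkAll n E (check n E false) &&
        forallRows tf n E fun r => close tf k (n + 1) (r.map (fun i => (i, n)) ++ E))

section Closing

variable {V : Type} {G : SimpleGraph V} {n : ℕ} {E : List (ℕ × ℕ)} {fl tf : Bool}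
  {st : ℕ → ℕ} {u v : ℕ → V}

theorem of_forallStatus {p : List ℕ → Bool} : ∀ {i : ℕ} {L : List ℕ},
    forallStatus n E p i L = true → (∀ j < i, st j ≤ 2) → (∀ j < i, 3 ≤ edeg n E j → st j = 2) →
    p ((List.range i).map st ++ L) = true
  | 0, L, h, _, _ => h
  | i + 1, L, h, h2, h3 => by
    simp only [forallStatus, Bool.and_eq_true, Bool.or_eq_true, Nat.ble_eq] at h
    rw [List.range_succ, List.map_append, List.append_assoc]
    refine of_forallStatus ?_ (fun j hj => h2 j (by omega)) fun j hj => h3 j (by omega)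
    have h2i := h2 i (by omega)
    have h3i := h3 i (by omega)
    by_cases hst : st i = 2
    · simpa [hst] using h.1
    · have := h.2.resolve_left fun h => hst (h3i h)
      interval_cases hsti : st i
      · simpa [hsti] using this.1
      · simpa [hsti] using this.2
      · exact absurd rfl hst

theorem Config.congr {st' : ℕ → ℕ} (C : Config G n E fl st u v) (h : ∀ i < n, st' i = st i) :
    Config G n E fl st' u v where
  lt := C.lt
  inj := C.inj
  adj := C.adj
  nbr i hi := by rw [h i hi]; exact C.nbr i hi
  leave i hi := by rw [h i hi]; exact C.leave i hi
  outside i hi := by rw [h i hi]; exact C.outside i hi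
  vinj i hi j hj := by rw [h i hi, h j hj]; exact C.vinj i hi j hj
  st_le i hi := by rw [h i hi]; exact C.st_le i hi
  deg_eq i hi := by rw [h i hi]; exact C.deg_eq i hi
  deg_le i hi := by rw [h i hi]; exact C.deg_le i hi
  indep hfl i hi j hj := by rw [h i hi, h j hj]; exact C.indep hfl i hi j hj

theorem Config.exists_of_checkAll [Finite V] (hG : Subcubic G) (C : Config G n E fl st u v)
    {p : (ℕ → ℕ) → Bool} (h : checkAll n E p = true) :
    ∃ st' : ℕ → ℕ, (∀ i < n, st' i = st i) ∧ p st' = true := by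
  refine ⟨fun i => ((List.range n).map st).getD i 2, fun i hi => ?_, ?_⟩
  · simp [List.getD_eq_getElem?_getD, hi]
  · have := of_forallStatus h C.st_le fun j hj h3 => by
      have h1 := C.edeg_le hj
      have h2 := hG (u j)
      by_contra hst
      rw [beq_eq_false_iff_ne.2 hst, cond_false] at h1
      omega
    rwa [List.append_nil] at this

theorem Config.false_of_checkAll [Finite V] (hG : MinCounter V G) (C : Config G n E fl st u v)
    (hE : E ≠ []) (hnd : E.Nodup) (h : checkAll n E (check n E fl) = true) : False := by
  obtain ⟨st', hst, h⟩ := C.exists_of_checkAll hG.1 h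
  exact (C.congr hst).false_of_check hG hE hnd h

theorem Config.adj_of_checkAll [Finite V] (hG : MinCounter V G) (C : Config G n E false st u v)
    (hE : E ≠ []) (hnd : E.Nodup) {P Q : ℕ} (hP : P < n) (hQ : Q < n) (hPQ : P ≠ Q)
    (hj : joined E P Q = false) (h : checkAll n E (checkAdd n E P Q) = true) :
    st P ≠ 2 ∧ st Q ≠ 2 ∧ G.Adj (v P) (v Q) := by
  obtain ⟨st', hst, h⟩ := C.exists_of_checkAll hG.1 h
  rw [← hst P hP, ← hst Q hQ]
  exact (C.congr hst).adj_of_checkAdd hG hE hnd hP hQ hPQ hj h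

/-- If no vertex has two neighbors in an induced subgraph, then the subgraph and its neighbors form
a configuration. -/
theorem Emb.exists_config [Finite V] (hG : Subcubic G) (M : Emb G n E u)
    (hdeg : ∀ i < n, (G.neighborSet (u i)).ncard ≤ edeg n E i + 1)
    (hsep : ∀ i < n, ∀ j < n, ∀ x, (∀ k < n, x ≠ u k) → G.Adj (u i) x → G.Adj (u j) x → i = j)
    (hfl : fl = true → ∀ x y, (G.neighborSet x).ncard ≤ 2 → (G.neighborSet y).ncard ≤ 2 →
      ¬G.Adj x y) : ∃ st v, Config G n E fl st u v := by
  have key : ∀ i, ∃ (s : ℕ) (x : V), i < n → s ≤ 2 ∧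
      (s ≠ 2 → G.Adj (u i) x ∧ ∀ j < n, x ≠ u j) ∧
      (∀ y, G.Adj (u i) y → (∃ j < n, y = u j) ∨ (s ≠ 2 ∧ y = x)) ∧
      (s = 0 → (G.neighborSet x).ncard = 3) ∧ (s = 1 → (G.neighborSet x).ncard ≤ 2) := by
    intro i
    by_cases h : ∃ x, G.Adj (u i) x ∧ ∀ j < n, x ≠ u j
    · obtain ⟨x, hx, hxu⟩ := h
      refine ⟨if (G.neighborSet x).ncard = 3 then 0 else 1, x, fun hi => ?_⟩
      have hxG := hG x
      refine ⟨by split_ifs <;> omega, fun _ => ⟨hx, hxu⟩, fun y hy => ?_,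
        fun h => by_contra fun h3 => by simp [h3] at h, fun h => ?_⟩
      · by_contra! hne
        have hyx : y ≠ x := hne.2 (by split_ifs <;> omega)
        have h1 := M.edeg_add_ncard_le hi (S := {y, x})
          (by rintro z (rfl | rfl); exacts [hy, hx])
          (by rintro z (rfl | rfl); exacts [hne.1, hxu])
        have h2 := hdeg i hi
        rw [Set.ncard_pair hyx] at h1
        omega
      · by_contra h3
        rw [if_pos (by omega)] at h
        omega
    · push Not at h
      refine ⟨2, u i, fun _ => ⟨le_rfl, fun h => absurd rfl h, fun y hy => Or.inl (h y hy),
        by simp, by simp⟩⟩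
  choose st v hst using key
  exact ⟨st, v, {
    lt := M.lt
    inj := M.inj
    adj := M.adj
    nbr := fun i hi => (hst i hi).2.2.1
    leave := fun i hi h => ((hst i hi).2.1 h).1
    outside := fun i hi h => ((hst i hi).2.1 h).2
    vinj := fun i hi j hj h1 h2 h => hsep i hi j hj (v i) ((hst i hi).2.1 h1).2
      ((hst i hi).2.1 h1).1 (h ▸ ((hst j hj).2.1 h2).1)
    st_le := fun i hi => (hst i hi).1
    deg_eq := fun i hi => (hst i hi).2.2.2.1
    deg_le := fun i hi => (hst i hi).2.2.2.2
    indep := fun h i hi j hj h1 h2 =>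
      hfl h _ _ ((hst i hi).2.2.2.2 h1) ((hst j hj).2.2.2.2 h2) }⟩

theorem Emb.absorb (M : Emb G n E u) {x : V} (hx : ∀ i < n, x ≠ u i) {R : List ℕ}
    (hR : ∀ i, i ∈ R ↔ i < n ∧ G.Adj (u i) x) :
    Emb G (n + 1) (R.map (fun i => (i, n)) ++ E) (Function.update u n x) := by
  have hu : ∀ i < n, Function.update u n x i = u i := fun i hi =>
    Function.update_of_ne hi.ne _ _
  have hmem : ∀ i j, (i, j) ∈ R.map (fun i => (i, n)) ++ E ↔
      (j = n ∧ i < n ∧ G.Adj (u i) x) ∨ (i, j) ∈ E := by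
    intro i j
    simp only [List.mem_append, List.mem_map, Prod.mk.injEq]
    refine or_congr_left ⟨?_, fun h => ⟨i, (hR i).2 h.2, rfl, h.1.symm⟩⟩
    rintro ⟨k, hk, rfl, rfl⟩
    exact ⟨rfl, (hR k).1 hk⟩
  refine ⟨fun e he => ?_, fun i hi j hj h => ?_, fun i hi j hj => ?_⟩
  · rcases (hmem e.1 e.2).1 he with h | h
    · omega
    · have := M.lt e h
      omega
  · rcases Nat.lt_succ_iff_lt_or_eq.1 hi with hi | rfl <;>
      rcases Nat.lt_succ_iff_lt_or_eq.1 hj with hj | rfl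
    · exact M.inj i hi j hj (by rwa [hu i hi, hu j hj] at h)
    · rw [hu i hi, Function.update_self] at h
      exact absurd h.symm (hx i hi)
    · rw [hu j hj, Function.update_self] at h
      exact absurd h (hx j hj)
    · rfl
  · rw [joined_iff, hmem, hmem]
    have hlt : ∀ i j, (i, j) ∈ E → i < n ∧ j < n := fun i j h => by
      have := M.lt _ h
      simp only at this
      omega
    rcases Nat.lt_succ_iff_lt_or_eq.1 hi with hi | rfl <;>
      rcases Nat.lt_succ_iff_lt_or_eq.1 hj with hj | rfl
    · rw [hu i hi, hu j hj, M.adj i hi j hj, joined_iff]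
      simp [hi.ne, hj.ne]
    · rw [hu i hi, Function.update_self]
      have h1 : (i, j) ∉ E := fun h => (hlt _ _ h).2.false
      have h2 : (j, i) ∉ E := fun h => (hlt _ _ h).1.false
      simp [h1, h2, hi]
    · rw [hu j hj, Function.update_self, G.adj_comm]
      have h1 : (i, j) ∉ E := fun h => (hlt _ _ h).1.false
      have h2 : (j, i) ∉ E := fun h => (hlt _ _ h).2.false
      simp [h1, h2, hj]
    · have h1 : ∀ k, (k, k) ∉ E := fun k h => (M.lt _ h).1.false
      simp [h1]

theorem Emb.nodup_absorb (M : Emb G n E u) (hnd : E.Nodup) {R : List ℕ} (hR : R.Nodup) :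
    (R.map (fun i => (i, n)) ++ E).Nodup := by
  rw [List.nodup_append]
  refine ⟨hR.map fun i j h => congrArg Prod.fst h, hnd, ?_⟩
  rintro a ha b hb rfl
  obtain ⟨i, -, rfl⟩ := List.mem_map.1 ha
  exact (M.lt _ hb).2.false

theorem Emb.exists_absorb [Finite V] (hG : Subcubic G)
    (htf : tf = true → ∀ x y z, G.Adj x y → G.Adj x z → ¬G.Adj y z) (M : Emb G n E u)
    (hnd : E.Nodup) {p : List ℕ → Bool} (h : forallRows tf n E p = true) {i j : ℕ} (hi : i < n)
    (hj : j < n) (hij : i ≠ j) {x : V} (hx : ∀ k < n, x ≠ u k) (hix : G.Adj (u i) x)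
    (hjx : G.Adj (u j) x) : ∃ R : List ℕ, p R = true ∧ (R.map (fun i => (i, n)) ++ E).Nodup ∧
      Emb G (n + 1) (R.map (fun i => (i, n)) ++ E) (Function.update u n x) := by
  classical
  obtain ⟨R, hR⟩ : ∃ R, R = (List.range n).filter fun i => decide (i < n ∧ G.Adj (u i) x) :=
    ⟨_, rfl⟩
  have hmem : ∀ i, i ∈ R ↔ i < n ∧ G.Adj (u i) x := by simp [hR]
  have hRnd : R.Nodup := hR ▸ List.nodup_range.filter _
  refine ⟨R, ?_, M.nodup_absorb hnd hRnd, M.absorb hx hmem⟩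
  have hsub : R.Sublist ((List.range n).filter fun i => Nat.ble (edeg n E i) 2) := by
    rw [hR]
    refine List.monotone_filter_right _ fun i hi => ?_
    obtain ⟨hi, hix⟩ := of_decide_eq_true hi
    have h1 := M.edeg_add_ncard_le hi (S := {x}) (by simpa using hix) (by simpa using hx)
    have h2 := hG (u i)
    rw [Set.ncard_singleton] at h1
    simp only [Nat.ble_eq]
    omega
  have hlen2 : 2 ≤ R.length := by
    have h1 : ({i, j} : Finset ℕ) ⊆ R.toFinset := by
      rw [Finset.insert_subset_iff, Finset.singleton_subset_iff, List.mem_toFinset,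
        List.mem_toFinset]
      exact ⟨(hmem i).2 ⟨hi, hix⟩, (hmem j).2 ⟨hj, hjx⟩⟩
    have h2 := Finset.card_le_card h1
    rwa [Finset.card_pair hij, List.toFinset_card_of_nodup hRnd] at h2
  have hlen3 : R.length ≤ 3 := by
    rw [← List.toFinset_card_of_nodup hRnd, ← Set.ncard_coe_finset,
      ← Set.InjOn.ncard_image (f := u)]
    · refine (Set.ncard_le_ncard ?_ (Set.toFinite _)).trans (hG x)
      rintro _ ⟨i, hi, rfl⟩
      exact ((hmem i).1 (List.mem_toFinset.1 hi)).2.symm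
    · intro i hi j hj
      exact M.inj i ((hmem i).1 (List.mem_toFinset.1 hi)).1 j
        ((hmem j).1 (List.mem_toFinset.1 hj)).1
  simp only [forallRows, List.all_eq_true, Bool.or_eq_true, Bool.and_eq_true, List.any_eq_true,
    List.mem_append, List.mem_sublistsLen] at h
  refine (h R ?_).resolve_left ?_
  · rw [← and_or_left]
    exact ⟨hsub, by omega⟩
  · rintro ⟨h0, i, hi, j, hj, hij⟩
    obtain ⟨hi, hix⟩ := (hmem i).1 hi
    obtain ⟨hj, hjx⟩ := (hmem j).1 hj
    exact htf h0 _ _ _ hix.symm hjx.symm ((M.adj i hi j hj).2 hij)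

theorem Emb.false_of_close [Finite V] (hG : MinCounter V G)
    (htf : tf = true → ∀ x y z, G.Adj x y → G.Adj x z → ¬G.Adj y z) :
    ∀ {k n : ℕ} {E : List (ℕ × ℕ)} {u : ℕ → V}, Emb G n E u → E ≠ [] → E.Nodup →
      close tf k n E = true → False
  | 0, _, _, _, _, _, _, h => by simp [close] at h
  | k + 1, n, E, u, M, hE, hnd, h => by
    simp only [close, Bool.or_eq_true, Bool.and_eq_true, Bool.not_eq_true', List.all_eq_false,
      List.all_eq_true, List.mem_range, Nat.ble_eq] at h
    rcases h with ⟨i, hi, h⟩ | ⟨⟨h2, h3⟩, h4⟩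
    · have h1 := M.edeg_add_ncard_le hi (Set.empty_subset _) (by simp)
      have h2 := hG.1 (u i)
      omega
    by_cases hsep : ∀ i < n, ∀ j < n, ∀ x, (∀ k < n, x ≠ u k) → G.Adj (u i) x →
        G.Adj (u j) x → i = j
    · obtain ⟨st, v, C⟩ := M.exists_config (fl := false) hG.1
        (fun i hi => (hG.1 _).trans (by have := h2 i hi; omega)) hsep (by simp)
      exact C.false_of_checkAll hG hE hnd h3
    · push Not at hsep
      obtain ⟨i, hi, j, hj, x, hx, hix, hjx, hij⟩ := hsep
      obtain ⟨R, hR, hnd, M⟩ := M.exists_absorb hG.1 htf hnd h4 hi hj hij hx hix hjx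
      exact M.false_of_close hG htf (by simp [hE]) hnd hR

end Closing

/-! ### Finite checks -/

section FiniteChecks

set_option maxRecDepth 100000

theorem close_triangle : close false 8 3 [(0, 1), (0, 2), (1, 2)] = true := by decide +kernel

theorem checkAll_edge : checkAll 2 [(0, 1)] (check 2 [(0, 1)] false) = true := by decide +kernel

theorem forallRows_K23 : forallRows true 5 [(0, 4), (2, 4), (0, 1), (1, 2), (2, 3), (0, 3)]
    (fun r => close true 8 6
      (r.map (fun i => (i, 5)) ++ [(0, 4), (2, 4), (0, 1), (1, 2), (2, 3), (0, 3)])) = true := by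
  decide +kernel

theorem checkAdd_K23 : checkAll 5 [(0, 4), (2, 4), (0, 1), (1, 2), (2, 3), (0, 3)]
    (checkAdd 5 [(0, 4), (2, 4), (0, 1), (1, 2), (2, 3), (0, 3)] 1 3) = true := by
  decide +kernel

theorem close_K23_add : close true 8 7
    [(3, 6), (5, 6), (1, 5), (0, 4), (2, 4), (0, 1), (1, 2), (2, 3), (0, 3)] = true := by
  decide +kernel

theorem checkAdd_square : checkAll 4 [(0, 1), (1, 2), (2, 3), (0, 3)]
    (checkAdd 4 [(0, 1), (1, 2), (2, 3), (0, 3)] 0 2) = true := by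
  decide +kernel

/-- A square and its neighbors, where the neighbors of opposite vertices are adjacent. -/
def squareAdd : List (ℕ × ℕ) :=
  [(3, 7), (6, 7), (1, 6), (2, 5), (4, 5), (0, 4), (0, 1), (1, 2), (2, 3), (0, 3)]

theorem checkAll_squareAdd : checkAll 8 squareAdd (check 8 squareAdd false) = true := by
  decide +kernel

theorem close_squareAdd_four_six : close true 7 9 ((4, 8) :: (6, 8) :: squareAdd) = true := by
  decide +kernel

theorem close_squareAdd_four_seven : close true 7 9 ((4, 8) :: (7, 8) :: squareAdd) = true := by
  decide +kernel

theorem close_squareAdd_five_six : close true 7 9 ((5, 8) :: (6, 8) :: squareAdd) = true := by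
  decide +kernel

theorem close_squareAdd_five_seven : close true 7 9 ((5, 8) :: (7, 8) :: squareAdd) = true := by
  decide +kernel

theorem forallRows_squareAdd (p : List ℕ → Bool) : forallRows true 8 squareAdd p =
    ([[5, 7], [5, 6], [4, 7], [4, 6]].all p) := by
  rfl

theorem close_squareAdd : close true 8 8 squareAdd = true := by
  have h : (List.range 8).all (fun i => Nat.ble 2 (edeg 8 squareAdd i)) = true := by decide
  rw [close, h, checkAll_squareAdd, forallRows_squareAdd]
  simp [close_squareAdd_four_six, close_squareAdd_four_seven, close_squareAdd_five_six,
    close_squareAdd_five_seven]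

theorem close_square_of_or : ∀ b₄ b₅ c₄ c₅ : Bool, (b₄ || b₅ || c₄ || c₅) = true → close true 8 8
    (([3, 6] ++ (bif c₄ then [4] else []) ++ bif c₅ then [5] else []).map (fun i => (i, 7)) ++
      (([1] ++ (bif b₄ then [4] else []) ++ bif b₅ then [5] else []).map (fun i => (i, 6)) ++
      [(2, 5), (4, 5), (0, 4), (0, 1), (1, 2), (2, 3), (0, 3)])) = true := by
  decide +kernel

theorem close_square (b₄ b₅ c₄ c₅ : Bool) : close true 8 8
    (([3, 6] ++ (bif c₄ then [4] else []) ++ bif c₅ then [5] else []).map (fun i => (i, 7)) ++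
      (([1] ++ (bif b₄ then [4] else []) ++ bif b₅ then [5] else []).map (fun i => (i, 6)) ++
      [(2, 5), (4, 5), (0, 4), (0, 1), (1, 2), (2, 3), (0, 3)])) = true := by
  by_cases h : (b₄ || b₅ || c₄ || c₅) = true
  · exact close_square_of_or b₄ b₅ c₄ c₅ h
  · simp only [Bool.not_eq_true, Bool.or_eq_false_iff] at h
    obtain ⟨⟨⟨rfl, rfl⟩, rfl⟩, rfl⟩ := h
    exact close_squareAdd

/-- The statuses of the vertices of a `5`-cycle, up to rotation and reflection. -/
def pentagonStatuses : List (List ℕ) :=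
  [[0,0,0,0,0],[1,0,0,0,0],[0,0,0,0,2],[1,1,0,0,0],[1,2,0,0,0],[0,0,0,2,2],[1,0,0,1,0],[1,0,0,2,0],
   [1,1,1,0,0],[1,1,0,0,2],[1,2,1,0,0],[1,0,0,2,2],[0,0,2,0,2],[1,2,0,0,2],[0,0,2,2,2],[1,0,1,1,0],
   [1,0,1,2,0],[1,0,2,2,0],[1,1,0,2,0],[1,1,1,1,0],[1,1,1,2,0],[1,1,2,1,0],[1,1,0,2,2],[1,0,2,0,2],
   [1,2,1,0,2],[1,2,2,1,0],[1,0,2,2,2],[0,2,0,2,2],[1,1,2,0,2],[1,2,0,2,2],[0,2,2,2,2],[1,1,1,1,1],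
   [1,1,1,1,2],[1,1,1,2,2],[1,1,2,1,2],[1,1,2,2,2],[1,2,1,2,2],[1,2,2,2,2],[2,2,2,2,2]]

theorem check_pentagon : pentagonStatuses.all (fun L =>
    check 5 [(0, 1), (1, 2), (2, 3), (3, 4), (0, 4)] true fun i => L.getD i 2) = true := by
  decide +kernel

theorem exists_mem_pentagonStatuses : ∀ a b c d e : Fin 3, ∃ i < 5, ∃ j ∈ [1, 4],
    (List.range 5).map (fun k => [a.1, b.1, c.1, d.1, e.1].getD ((i + j * k) % 5) 2) ∈
      pentagonStatuses := by
  decide +kernel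

end FiniteChecks

/-! ### Short cycles -/

section ShortCycles

variable {V : Type} {G : SimpleGraph V} {n : ℕ} {E : List (ℕ × ℕ)} {fl : Bool} {st : ℕ → ℕ}
  {u v : ℕ → V} {a b c d e : V}

theorem Emb.of_lt (hlt : ∀ e ∈ E, e.1 < e.2 ∧ e.2 < n)
    (h : ∀ j < n, ∀ i < j, u i ≠ u j ∧ (G.Adj (u i) (u j) ↔ joined E i j = true)) :
    Emb G n E u where
  lt := hlt
  inj i hi j hj hij := by
    rcases lt_trichotomy i j with h1 | h1 | h1
    · exact absurd hij (h j hj i h1).1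
    · exact h1
    · exact absurd hij.symm (h i hi j h1).1
  adj i hi j hj := by
    rcases lt_trichotomy i j with h1 | rfl | h1
    · exact (h j hj i h1).2
    · have h1 : (i, i) ∉ E := fun h => (hlt _ h).1.false
      simp [joined_iff, h1]
    · rw [G.adj_comm, joined_comm]
      exact (h i hi j h1).2

/-- Relabel the vertices of a configuration. -/
theorem Config.comp (C : Config G n E fl st u v) {σ : ℕ → ℕ} (hσ : ∀ i < n, σ i < n)
    (hinj : ∀ i < n, ∀ j < n, σ i = σ j → i = j)
    (hE : ∀ i < n, ∀ j < n, joined E (σ i) (σ j) = joined E i j) :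
    Config G n E fl (fun i => st (σ i)) (fun i => u (σ i)) (fun i => v (σ i)) where
  lt := C.lt
  inj i hi j hj h := hinj i hi j hj (C.inj _ (hσ i hi) _ (hσ j hj) h)
  adj i hi j hj := by rw [C.adj _ (hσ i hi) _ (hσ j hj), hE i hi j hj]
  nbr i hi x hx := by
    refine (C.nbr _ (hσ i hi) x hx).imp_left ?_
    rintro ⟨j, hj, rfl⟩
    obtain ⟨k, hk, rfl⟩ := Finset.surj_on_of_inj_on_of_card_le (s := Finset.range n)
      (t := Finset.range n) (fun i _ => σ i) (fun i hi => by simpa using hσ i (by simpa using hi))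
      (fun i j hi hj => hinj i (by simpa using hi) j (by simpa using hj)) le_rfl j (by simpa)
    exact ⟨k, by simpa using hk, rfl⟩
  leave i hi := C.leave _ (hσ i hi)
  outside i hi h j hj := C.outside _ (hσ i hi) h _ (hσ j hj)
  vinj i hi j hj h1 h2 h := hinj i hi j hj (C.vinj _ (hσ i hi) _ (hσ j hj) h1 h2 h)
  st_le i hi := C.st_le _ (hσ i hi)
  deg_eq i hi := C.deg_eq _ (hσ i hi)
  deg_le i hi := C.deg_le _ (hσ i hi)
  indep h i hi j hj := C.indep h _ (hσ i hi) _ (hσ j hj)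

theorem Config.adj_iff (C : Config G n E fl st u v) {i j : ℕ} (hi : i < n) (hj : j < n)
    (hst : st j ≠ 2) : G.Adj (u i) (v j) ↔ i = j := by
  constructor
  · intro h
    rcases C.nbr i hi _ h with ⟨k, hk, h⟩ | ⟨h1, h2⟩
    · exact absurd h (C.outside j hj hst k hk)
    · exact (C.vinj j hj i hi hst h1 h2).symm
  · rintro rfl
    exact C.leave i hi hst

/-- Add two adjacent outside vertices to a configuration. -/
theorem Config.emb_add (C : Config G n E fl st u v) {P Q : ℕ} (hP : P < n) (hQ : Q < n)
    (hPQ : P ≠ Q) (hstP : st P ≠ 2) (hstQ : st Q ≠ 2) (h : G.Adj (v P) (v Q)) :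
    Emb G (n + 2) ((Q, n + 1) :: (n, n + 1) :: (P, n) :: E)
      (Function.update (Function.update u n (v P)) (n + 1) (v Q)) := by
  have M : Emb G n E u := ⟨C.lt, C.inj, C.adj⟩
  refine (M.absorb (C.outside P hP hstP) (R := [P]) fun i => ?_).absorb (R := [Q, n])
    (fun i hi => ?_) fun i => ?_
  · rw [List.mem_singleton]
    exact ⟨fun h => by subst h; exact ⟨hP, C.leave _ hP hstP⟩,
      fun h => (C.adj_iff h.1 hP hstP).1 h.2⟩
  · rcases Nat.lt_succ_iff_lt_or_eq.1 hi with hi | rfl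
    · rw [Function.update_of_ne hi.ne]
      exact C.outside Q hQ hstQ i hi
    · rw [Function.update_self]
      exact h.ne'
  · rcases lt_trichotomy i n with hi | rfl | hi
    · rw [Function.update_of_ne hi.ne, C.adj_iff hi hQ hstQ]
      simp only [List.mem_cons, List.not_mem_nil, or_false]
      omega
    · simpa using h
    · simp only [List.mem_cons, List.not_mem_nil, or_false]
      omega

theorem MinCounter.triangle_free [Finite V] (hG : MinCounter V G) (hab : G.Adj a b)
    (hac : G.Adj a c) : ¬G.Adj b c := by
  intro hbc
  have M : Emb G 3 [(0, 1), (0, 2), (1, 2)] (fun i => [a, b, c].getD i a) := by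
    refine Emb.of_lt (by decide) fun j hj i hi => ?_
    interval_cases j <;> interval_cases i <;> simp [joined, hab, hac, hbc, hab.ne, hac.ne, hbc.ne]
  exact M.false_of_close hG (by simp) (by simp) (by decide) close_triangle

theorem MinCounter.not_adj_of_ncard_le [Finite V] (hG : MinCounter V G)
    (ha : (G.neighborSet a).ncard ≤ 2) (hb : (G.neighborSet b).ncard ≤ 2) : ¬G.Adj a b := by
  intro hab
  have M : Emb G 2 [(0, 1)] (fun i => [a, b].getD i a) := by
    refine Emb.of_lt (by decide) fun j hj i hi => ?_
    interval_cases j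
    · omega
    · interval_cases i
      simp [joined, hab, hab.ne]
  obtain ⟨st, v, C⟩ := M.exists_config (fl := false) hG.1 (fun i hi => by
      interval_cases i
      · exact ha
      · exact hb) (fun i hi j hj x _ h1 h2 => by
      interval_cases i <;> interval_cases j
      · rfl
      · exact absurd h2 (hG.triangle_free hab h1)
      · exact absurd h1 (hG.triangle_free hab h2)
      · rfl) (by simp)
  exact C.false_of_checkAll hG (by simp) (by decide) checkAll_edge

theorem MinCounter.not_adj_of_two_common [Finite V] (hG : MinCounter V G) (hac : a ≠ c)
    (hbd : b ≠ d) (hbe : b ≠ e) (hde : d ≠ e) (hab : G.Adj a b) (had : G.Adj a d)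
    (hae : G.Adj a e) (hbc : G.Adj b c) (hcd : G.Adj c d) : ¬G.Adj c e := by
  intro hce
  have nac : ¬G.Adj a c := fun h => hG.triangle_free hab h hbc
  have nbd := hG.triangle_free hab had
  have nbe := hG.triangle_free hab hae
  have nde := hG.triangle_free had hae
  have htf : true = true → ∀ x y z, G.Adj x y → G.Adj x z → ¬G.Adj y z :=
    fun _ _ _ _ => hG.triangle_free
  have M : Emb G 5 [(0, 4), (2, 4), (0, 1), (1, 2), (2, 3), (0, 3)]
      (fun i => [a, b, c, d, e].getD i a) := by
    refine Emb.of_lt (by decide) fun j hj i hi => ?_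
    interval_cases j <;> interval_cases i <;>
      simp [joined, *, hab.ne, had.ne, hae.ne, hbc.ne, hcd.ne, hce.ne]
  obtain ⟨st, v, C⟩ := M.exists_config (fl := false) hG.1 (fun i hi => (hG.1 _).trans (by
      interval_cases i <;> decide)) (fun i hi j hj x hx h1 h2 => by
      by_contra hij
      obtain ⟨R, hR, hnd, M'⟩ := M.exists_absorb hG.1 htf (by decide) forallRows_K23 hi hj hij
        hx h1 h2
      exact M'.false_of_close hG htf (by simp) hnd hR) (by simp)
  obtain ⟨h1, h3, hv⟩ := C.adj_of_checkAll hG (by simp) (by decide) (by decide) (by decide)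
    (by decide) (by decide) checkAdd_K23
  exact (C.emb_add (by decide) (by decide) (by decide) h1 h3 hv).false_of_close hG htf (by simp)
    (by decide) close_K23_add

/-- A square does not form a configuration together with its neighbors. -/
theorem Config.false_of_square [Finite V] (hG : MinCounter V G)
    (C : Config G 4 [(0, 1), (1, 2), (2, 3), (0, 3)] false st u v) : False := by
  obtain ⟨h0, h2, hv⟩ := C.adj_of_checkAll hG (by simp) (by decide) (by decide) (by decide)
    (by decide) (by decide) checkAdd_square
  obtain ⟨h1, h3, hv'⟩ := (C.comp (σ := fun i => (i + 1) % 4) (by omega) (by omega)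
    (by decide)).adj_of_checkAll hG (by simp) (by decide) (by decide) (by decide) (by decide)
    (by decide) checkAdd_square
  change st 1 ≠ 2 at h1
  change st 3 ≠ 2 at h3
  change G.Adj (v 1) (v 3) at hv'
  classical
  have hne : ∀ i < 4, ∀ j < 4, i ≠ j → st i ≠ 2 → st j ≠ 2 → v i ≠ v j :=
    fun i hi j hj hij h1 h2 h => hij (C.vinj i hi j hj h1 h2 h)
  have hbif : ∀ (p : Prop) [Decidable p] (i j : ℕ), i ∈ (bif decide p then [j] else []) ↔
      i = j ∧ p := by
    intro p _ i j
    by_cases hp : p <;> simp [hp]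
  have M1 := C.emb_add (by decide) (by decide) (by decide) h0 h2 hv
  have M2 := M1.absorb (x := v 1) (R := [1] ++ (bif decide (G.Adj (v 0) (v 1)) then [4] else []) ++
    bif decide (G.Adj (v 2) (v 1)) then [5] else []) (fun i hi => ?_) (fun i => ?_)
  have M3 := M2.absorb (x := v 3) (R := [3, 6] ++
    (bif decide (G.Adj (v 0) (v 3)) then [4] else []) ++
    bif decide (G.Adj (v 2) (v 3)) then [5] else []) (fun i hi => ?_) (fun i => ?_)
  · refine M3.false_of_close hG (tf := true) (fun _ _ _ _ => hG.triangle_free) (by simp) ?_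
      (close_square _ _ _ _)
    generalize decide (G.Adj (v 0) (v 1)) = b₄
    generalize decide (G.Adj (v 2) (v 1)) = b₅
    generalize decide (G.Adj (v 0) (v 3)) = c₄
    generalize decide (G.Adj (v 2) (v 3)) = c₅
    revert b₄ b₅ c₄ c₅
    decide
  · rcases Nat.lt_or_ge i 4 with h4 | h4
    · simp only [show i ≠ 4 by omega, show i ≠ 5 by omega, show i ≠ 6 by omega,
        Function.update_of_ne, ne_eq, not_false_eq_true, Nat.reduceAdd]
      exact C.outside 3 (by decide) h3 i h4
    · interval_cases i
      · simpa using hne 3 (by decide) 0 (by decide) (by decide) h3 h0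
      · simpa using hne 3 (by decide) 2 (by decide) (by decide) h3 h2
      · simpa using hne 3 (by decide) 1 (by decide) (by decide) h3 h1
  · simp only [List.mem_append, List.mem_cons, List.not_mem_nil, or_false, hbif]
    rcases Nat.lt_or_ge i 4 with h4 | h4
    · simp only [show i ≠ 4 by omega, show i ≠ 5 by omega, show i ≠ 6 by omega,
        Function.update_of_ne, ne_eq, not_false_eq_true, Nat.reduceAdd,
          C.adj_iff h4 (show 3 < 4 by decide) h3]
      grind
    · rcases Nat.lt_or_ge i 7 with h7 | h7
      · interval_cases i <;> simp [hv']
      · omega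
  · rcases Nat.lt_or_ge i 4 with h4 | h4
    · simp only [show i ≠ 4 by omega, show i ≠ 5 by omega, Function.update_of_ne,
        ne_eq, not_false_eq_true, Nat.reduceAdd]
      exact C.outside 1 (by decide) h1 i h4
    · interval_cases i
      · simpa using hne 1 (by decide) 0 (by decide) (by decide) h1 h0
      · simpa using hne 1 (by decide) 2 (by decide) (by decide) h1 h2
  · simp only [List.mem_append, List.mem_cons, List.not_mem_nil, or_false, hbif]
    rcases Nat.lt_or_ge i 4 with h4 | h4
    · simp only [show i ≠ 4 by omega, show i ≠ 5 by omega, Function.update_of_ne,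
        ne_eq, not_false_eq_true, Nat.reduceAdd, C.adj_iff h4 (show 1 < 4 by decide) h1]
      grind
    · rcases Nat.lt_or_ge i 6 with h6 | h6
      · interval_cases i <;> simp
      · omega

theorem MinCounter.eq_or_eq_of_square [Finite V] (hG : MinCounter V G) (hab : G.Adj a b)
    (hbc : G.Adj b c) (hcd : G.Adj c d) (had : G.Adj a d) : a = c ∨ b = d := by
  by_contra! h
  obtain ⟨hac, hbd⟩ := h
  have nac : ¬G.Adj a c := fun h => hG.triangle_free hab h hbc
  have nbd := hG.triangle_free hab had
  have M : Emb G 4 [(0, 1), (1, 2), (2, 3), (0, 3)] (fun i => [a, b, c, d].getD i a) := by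
    refine Emb.of_lt (by decide) fun j hj i hi => ?_
    interval_cases j <;> interval_cases i <;>
      simp [joined, *, hab.ne, had.ne, hbc.ne, hcd.ne]
  have hsep : ∀ j < 4, ∀ i < j, ∀ x, (∀ k < 4, x ≠ [a, b, c, d].getD k a) →
      G.Adj ([a, b, c, d].getD i a) x → ¬G.Adj ([a, b, c, d].getD j a) x := by
    intro j hj i hi x hx h1 h2
    have h0 := hx 0 (by decide)
    have h1' := hx 1 (by decide)
    have h2' := hx 2 (by decide)
    have h3' := hx 3 (by decide)
    have hadj : joined [(0, 1), (1, 2), (2, 3), (0, 3)] i j = false := by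
      by_contra h
      exact hG.triangle_free h1 ((M.adj i (by omega) j hj).2 (by simpa using h)) h2.symm
    interval_cases j <;> interval_cases i <;> try exact absurd hadj (by decide)
    · exact hG.not_adj_of_two_common hac hbd h1'.symm h3'.symm hab had h1 hbc hcd h2
    · exact hG.not_adj_of_two_common hbd hac.symm h2'.symm h0.symm hbc hab.symm h1 hcd had.symm h2
  obtain ⟨st, v, C⟩ := M.exists_config (fl := false) hG.1 (fun i hi => (hG.1 _).trans (by
      interval_cases i <;> decide)) (fun i hi j hj x hx h1 h2 => by
      rcases lt_trichotomy i j with h | h | h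
      · exact absurd h2 (hsep j hj i h x hx h1)
      · exact h
      · exact absurd h1 (hsep i hi j h x hx h2)) (by simp)
  exact C.false_of_square hG

theorem MinCounter.false_of_pentagon [Finite V] (hG : MinCounter V G)
    (hinj : ∀ j < 5, ∀ i < j, u i ≠ u j)
    (hadj : ∀ i < 5, ∀ j < 5, joined [(0, 1), (1, 2), (2, 3), (3, 4), (0, 4)] i j = true →
      G.Adj (u i) (u j)) : False := by
  have hpath : ∀ i < 5, ∀ j < 5, i ≠ j →
      joined [(0, 1), (1, 2), (2, 3), (3, 4), (0, 4)] i j = true ∨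
        ∃ k < 5, joined [(0, 1), (1, 2), (2, 3), (3, 4), (0, 4)] k i = true ∧
        joined [(0, 1), (1, 2), (2, 3), (3, 4), (0, 4)] k j = true := by decide
  have M : Emb G 5 [(0, 1), (1, 2), (2, 3), (3, 4), (0, 4)] u := by
    refine Emb.of_lt (by decide) fun j hj i hi => ⟨hinj j hj i hi, fun h => ?_,
      hadj i (by omega) j hj⟩
    refine (hpath i (by omega) j hj hi.ne).resolve_right ?_
    rintro ⟨k, hk, h1, h2⟩
    exact hG.triangle_free (hadj k hk i (by omega) h1) (hadj k hk j hj h2) h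
  obtain ⟨st, v, C⟩ := M.exists_config (fl := true) hG.1 (fun i hi => (hG.1 _).trans (by
      interval_cases i <;> decide)) (fun i hi j hj x hx h1 h2 => by
      by_contra hij
      rcases hpath i hi j hj hij with h | ⟨k, hk, h3, h4⟩
      · exact hG.triangle_free h1 (hadj i hi j hj h) h2.symm
      · rcases hG.eq_or_eq_of_square h1.symm (hadj k hk i hi h3).symm (hadj k hk j hj h4) h2.symm
          with h | h
        · exact hx k hk h
        · exact hij (M.inj i hi j hj h))
    (fun _ _ _ => hG.not_adj_of_ncard_le)
  obtain ⟨a, ha, r, hr, h⟩ := exists_mem_pentagonStatuses ⟨st 0, by have := C.st_le 0; omega⟩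
    ⟨st 1, by have := C.st_le 1; omega⟩ ⟨st 2, by have := C.st_le 2; omega⟩
    ⟨st 3, by have := C.st_le 3; omega⟩ ⟨st 4, by have := C.st_le 4; omega⟩
  have hr' : r = 1 ∨ r = 4 := by simpa using hr
  refine ((C.comp (σ := fun i => (a + r * i) % 5) (by omega)
    (by rcases hr' with rfl | rfl <;> omega) ?_).congr fun i hi => ?_).false_of_check hG
    (by simp) (by decide) (List.all_eq_true.1 check_pentagon _ h)
  · clear h hr
    revert a
    rcases hr' with rfl | rfl <;> decide
  · have : (a + r * i) % 5 < 5 := by omega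
    simp only [List.getD_eq_getElem?_getD, List.getElem?_map, List.getElem?_range hi,
      Option.map_some, Option.getD_some]
    generalize (a + r * i) % 5 = k at *
    interval_cases k <;> rfl

end ShortCycles

/-- A minimal counterexample contains no cycle of length 5. -/
theorem minCounter_no_C5 {V : Type} [Finite V] (G : SimpleGraph V)
    (hG : MinCounter V G) :
    ∀ (v : V) (w : G.Walk v v), w.IsCycle → w.length ≠ 5 := by
  intro v w hw hlen
  refine hG.false_of_pentagon (u := fun i => w.getVert (i + 1)) (fun j hj i hi h => ?_)
    fun i hi j hj h => ?_
  · have := hw.getVert_injOn ⟨by omega, by omega⟩ ⟨by omega, by omega⟩ h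
    omega
  · have hs : ∀ i < 5, G.Adj (w.getVert i) (w.getVert (i + 1)) := fun i hi =>
      w.adj_getVert_succ (by omega)
    have h5 : w.getVert 5 = w.getVert 0 := by
      rw [w.getVert_zero, ← hlen, w.getVert_length]
    have h0 : G.Adj (w.getVert 5) (w.getVert 1) := h5 ▸ hs 0 (by decide)
    interval_cases i <;> interval_cases j <;> first
      | exact absurd h (by decide)
      | exact hs _ (by decide)
      | exact (hs _ (by decide)).symm
      | exact h0
      | exact h0.symm
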